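/- Consider the repulsive-partition model with prior exponent B > 9, grid constant C₁ > 32 p₀, and sup|f₀| < B₀. Assume f₀ ∈ C(t,M,η) with Assumption A1 (t ≤ 1), and assume the smoothness exponent t is piecewise Hölder (Assumption A4). Then there exists M̃ > 0 such that E_{f₀}[ 1_{Ω_n(u₁)} · Π( A_{ε_n}^c(M̃) | D_n ) ] = o(1) as n → ∞, where A_{ε_n}(M̃) = { sup_{x∈(0,1)} |f_β^S(x) − f₀(x)|/ε_n(x) ≤ M̃ } and Ω_n(u₁) = ∩_{ℓ=1}^{N_n} Ω_{n,z_ℓ}(u₁). -/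

import Mathlib

open MeasureTheory Filter Set ProbabilityTheory
open scoped ENNReal NNReal Classical BigOperators

noncomputable section

namespace Spatial

/-- the mother Haar wavelet ψ = 1_{(0,1/2]} − 1_{(1/2,1]} -/
def psi (x : ℝ) : ℝ :=
  if x ∈ Set.Ioc (0 : ℝ) (1 / 2) then 1 else if x ∈ Set.Ioc (1 / 2 : ℝ) 1 then -1 else 0

/-- the Haar wavelet ψ_{lk}(x) = 2^{l/2} ψ(2^l x − k) -/
def haar (l k : ℕ) (x : ℝ) : ℝ := (2 : ℝ) ^ ((l : ℝ) / 2) * psi ((2 : ℝ) ^ l * x - k)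

/-- the father wavelet ψ_{−1,0} = 1_{[0,1]} -/
def father (x : ℝ) : ℝ := if x ∈ Set.Icc (0 : ℝ) 1 then 1 else 0

/-- the dyadic interval I_{lk} = (k 2^{−l}, (k+1) 2^{−l}] -/
def dyadic (l k : ℕ) : Set ℝ := Set.Ioc ((k : ℝ) / 2 ^ l) (((k : ℝ) + 1) / 2 ^ l)

/-- the Haar coefficient β⁰_{lk} = ∫₀¹ f ψ_{lk} -/
def coef (f : ℝ → ℝ) (l k : ℕ) : ℝ := ∫ x in Set.Ioc (0 : ℝ) 1, f x * haar l k x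

/-- the father coefficient ⟨f, ψ_{−1,0}⟩ -/
def coefFather (f : ℝ → ℝ) : ℝ := ∫ x in Set.Ioc (0 : ℝ) 1, f x

/-- k_l(x) : the index k with x ∈ I_{lk} (for x ∈ (0,1]) -/
def kAt (l : ℕ) (x : ℝ) : ℕ := ⌈(2 : ℝ) ^ l * x⌉₊ - 1

/-- f belongs to the local Hölder class C(t,x,M,η) at the point x -/
def HolderAt (f : ℝ → ℝ) (t M η : ℝ) (x : ℝ) : Prop :=
  (∀ y ∈ Set.Icc (0 : ℝ) 1, |f y| ≤ M) ∧
    ∀ m : ℝ, m ≠ 0 → |m| ≤ η → x + m ∈ Set.Icc (0 : ℝ) 1 →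
      |f (x + m) - f x| ≤ M * |m| ^ t

/-- the class C(t,M,η) of locally Hölder functions -/
def HolderClass (t M η : ℝ → ℝ) : Set (ℝ → ℝ) :=
  {f | ∀ x ∈ Set.Icc (0 : ℝ) 1, HolderAt f (t x) (M x) (η x) x}

/-- Assumption A1 on the smoothness functions t, M, η -/
structure A1 (t M η : ℝ → ℝ) (t₁ : ℝ) : Prop where
  ht₁ : 0 < t₁
  t_lb : ∀ x ∈ Set.Icc (0 : ℝ) 1, t₁ ≤ t x
  t_ub : ∀ x ∈ Set.Icc (0 : ℝ) 1, t x ≤ 1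
  M_ub : ∃ Mmax > 0, ∀ x ∈ Set.Icc (0 : ℝ) 1, M x ≤ Mmax
  M_lb : ∃ Mmin > 0, ∀ x ∈ Set.Icc (0 : ℝ) 1, Mmin ≤ M x
  eta_ub : ∃ emax > 0, ∀ x ∈ Set.Icc (0 : ℝ) 1, η x ≤ emax
  eta_lb : ∃ emin > 0, ∀ x ∈ Set.Icc (0 : ℝ) 1, emin ≤ η x

/-- η_{lk} = min_{y ∈ I_{lk}} η(y) -/
def etaLK (η : ℝ → ℝ) (l k : ℕ) : ℝ := sInf (η '' dyadic l k)

/-- M_{lk} = max_{y ∈ I_{lk}} M(y) -/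
def MLK (M : ℝ → ℝ) (l k : ℕ) : ℝ := sSup (M '' dyadic l k)

/-- the local rate ζ_n(x) = (n/log n)^{t(x)/(2t(x)+1)} -/
def zeta (t : ℝ → ℝ) (n : ℕ) (x : ℝ) : ℝ :=
  ((n : ℝ) / Real.log n) ^ (t x / (2 * t x + 1))

/-- maximal resolution L_max = ⌊log₂ n⌋ -/
def Lmax (n : ℕ) : ℕ := Nat.log 2 n

/-- C_l(x) = (2 M_{l k_l(x)}/γ̄)^{1/(t(x)+1/2)} -/
def Cl (t M : ℝ → ℝ) (γ : ℝ) (l : ℕ) (x : ℝ) : ℝ :=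
  (2 * MLK M l (kAt l x) / γ) ^ ((1 : ℝ) / (t x + 1 / 2))

/-- the local depth d_l(x) -/
def dloc (t M : ℝ → ℝ) (γ : ℝ) (n l : ℕ) (x : ℝ) : ℝ :=
  (⌊Real.logb 2 (Cl t M γ l x * ((n : ℝ) / Real.log n) ^ ((1 : ℝ) / (2 * t x + 1)))⌋ : ℝ)

/-- the adjusted local depth d̃_l(x) -/
def dTilde (t M η : ℝ → ℝ) (γ : ℝ) (n l : ℕ) (x : ℝ) : ℝ :=
  max (Real.logb 2 (1 / (2 * etaLK η l (kAt l x)))) (dloc t M γ n l x)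


/-! ## The repulsive partition model -/

/-- knots of the grid -/
abbrev Knot (N : ℕ) := Fin (N + 1)

/-- the grid z₀ = 0 < … < z_N = 1 with spacing between C₁ log n/n and C₂ log n/n -/
def IsGrid (n N : ℕ) (z : Knot N → ℝ) (C₁ C₂ : ℝ) : Prop :=
  z 0 = 0 ∧ z (Fin.last N) = 1 ∧
    ∀ i : Fin N,
      C₁ * Real.log n / n ≤ z i.succ - z i.castSucc ∧
      z i.succ - z i.castSucc ≤ C₂ * Real.log n / n

/-- a subset of knots defining a partition of [0,1] -/
def IsPart (N : ℕ) (S : Finset (Knot N)) : Prop := 0 ∈ S ∧ Fin.last N ∈ S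

/-- i and j are consecutive knots of S (so that (z_i, z_j] is a block of S) -/
def Consec (N : ℕ) (S : Finset (Knot N)) (i j : Knot N) : Prop :=
  i ∈ S ∧ j ∈ S ∧ i < j ∧ ∀ m ∈ S, ¬(i < m ∧ m < j)

/-- the (unnormalised) repulsive prior weight π_S(S) ∝ Π_j |I_j^S|^B -/
def partWeight (N : ℕ) (z : Knot N → ℝ) (B : ℝ) (S : Finset (Knot N)) : ℝ :=
  if IsPart N S then
    ∏ q ∈ Finset.univ.filter (fun q : Knot N × Knot N => Consec N S q.1 q.2),
      (z q.2 - z q.1) ^ B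
  else 0

/-- conditions on the coefficient densities g_j: bounded above by c₁ and below by c₀
on [−B₀,B₀], nonnegative probability densities -/
def GoodDens (N : ℕ) (g : Knot N → ℝ → ℝ) (c₀ c₁ B₀ : ℝ) : Prop :=
  ∀ i : Knot N,
    (∀ b : ℝ, |b| ≤ B₀ → c₀ ≤ g i b) ∧ (∀ b : ℝ, 0 ≤ g i b) ∧
      (∀ b : ℝ, g i b ≤ c₁) ∧ (∫ b : ℝ, g i b) = 1

/-- the conditional prior on the block coefficients given a partition S -/
def partCondPrior (N : ℕ) (g : Knot N → ℝ → ℝ) (S : Finset (Knot N)) :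
    Measure (Knot N → ℝ) :=
  Measure.map
    (fun v : {i : Knot N // i ∈ S.erase 0} → ℝ =>
      fun i => if h : i ∈ S.erase 0 then v ⟨i, h⟩ else 0)
    ((volume : Measure ({i : Knot N // i ∈ S.erase 0} → ℝ)).withDensity fun v =>
      ENNReal.ofReal (∏ i, g i.1 (v i)))

/-- the step function f_β^S = Σ_j β_j 1_{I_j^S} (the block (z_i,z_j] carries the
coefficient indexed by its right knot j) -/
def fPart (N : ℕ) (z : Knot N → ℝ) (S : Finset (Knot N)) (β : Knot N → ℝ) (x : ℝ) : ℝ :=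
  ∑ j : Knot N, ∑ i : Knot N,
    if Consec N S i j ∧ x ∈ Set.Ioc (z i) (z j) then β j else 0

/-- the regression log-likelihood -/
def partLoglik (n N : ℕ) (z : Knot N → ℝ) (xd : Fin n → ℝ) (Y : Fin n → ℝ)
    (S : Finset (Knot N)) (β : Knot N → ℝ) : ℝ :=
  -(1 / 2 : ℝ) * ∑ i, (Y i - fPart N z S β (xd i)) ^ 2

/-- the posterior probability of an event A about (S,β) -/
def partPost (n N : ℕ) (z : Knot N → ℝ) (xd : Fin n → ℝ) (B : ℝ)
    (g : Knot N → ℝ → ℝ) (Y : Fin n → ℝ)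
    (A : Finset (Knot N) → (Knot N → ℝ) → Prop) : ℝ :=
  (∑ S : Finset (Knot N), partWeight N z B S *
      ∫ β, (if A S β then (1 : ℝ) else 0) * Real.exp (partLoglik n N z xd Y S β)
        ∂partCondPrior N g S) /
    ∑ S : Finset (Knot N), partWeight N z B S *
      ∫ β, Real.exp (partLoglik n N z xd Y S β) ∂partCondPrior N g S

/-- n_I : number of design points in (a,b] -/
def nIv (n : ℕ) (xd : Fin n → ℝ) (a b : ℝ) : ℕ :=
  (Finset.univ.filter fun i => xd i ∈ Set.Ioc a b).card

/-- ȳ_I : the mean of Y over the design points in (a,b] -/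
def ybar (n : ℕ) (xd : Fin n → ℝ) (Y : Fin n → ℝ) (a b : ℝ) : ℝ :=
  (∑ i ∈ Finset.univ.filter fun i => xd i ∈ Set.Ioc a b, Y i) / nIv n xd a b

/-- the intervals arising as the block I_x^S of some partition S ∈ 𝕊 -/
def IxPairs (N : ℕ) (z : Knot N → ℝ) (x : ℝ) : Set (Knot N × Knot N) :=
  {q | ∃ S : Finset (Knot N), IsPart N S ∧ Consec N S q.1 q.2 ∧
    x ∈ Set.Ioc (z q.1) (z q.2)}

/-- the intervals I(x) : blocks of some S which contain x or are adjacent to the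
block of S containing x -/
def IcalPairs (N : ℕ) (z : Knot N → ℝ) (x : ℝ) : Set (Knot N × Knot N) :=
  {q | ∃ S : Finset (Knot N), IsPart N S ∧ Consec N S q.1 q.2 ∧
    (x ∈ Set.Ioc (z q.1) (z q.2) ∨
      ∃ i j : Knot N, Consec N S i j ∧ x ∈ Set.Ioc (z i) (z j) ∧ (q.1 = j ∨ q.2 = i))}

/-- n_{I_x^S} -/
def nIx (n N : ℕ) (xd : Fin n → ℝ) (z : Knot N → ℝ) (S : Finset (Knot N)) (x : ℝ) : ℝ :=
  ∑ i : Knot N, ∑ j : Knot N,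
    if Consec N S i j ∧ x ∈ Set.Ioc (z i) (z j) then (nIv n xd (z i) (z j) : ℝ) else 0

/-- ȳ_{I_x^S} -/
def ybarIx (n N : ℕ) (xd : Fin n → ℝ) (z : Knot N → ℝ) (Y : Fin n → ℝ)
    (S : Finset (Knot N)) (x : ℝ) : ℝ :=
  ∑ i : Knot N, ∑ j : Knot N,
    if Consec N S i j ∧ x ∈ Set.Ioc (z i) (z j) then ybar n xd Y (z i) (z j) else 0

/-- the design event Ω_{n,x}(u₁) -/
def OmegaX (n N : ℕ) (xd : Fin n → ℝ) (z : Knot N → ℝ) (pI : ℝ → ℝ → ℝ)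
    (u₁ : ℝ) (x : ℝ) : Prop :=
  ∀ q ∈ IcalPairs N z x,
    |(nIv n xd (z q.1) (z q.2) : ℝ) - n * pI (z q.1) (z q.2)| ≤
      u₁ * Real.sqrt (Real.log n * (n * pI (z q.1) (z q.2)))

/-- the noise event Ω_{n,y}(u₀) -/
def OmegaY (n N : ℕ) (xd : Fin n → ℝ) (z : Knot N → ℝ) (u₀ : ℝ) (x : ℝ)
    (ε : Fin n → ℝ) : Prop :=
  ∀ q ∈ IxPairs N z x,
    |ybar n xd ε (z q.1) (z q.2)| ≤
      u₀ * Real.sqrt (Real.log n / nIv n xd (z q.1) (z q.2))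

/-- the noise event Ω_{n,y,2}(u₂) -/
def OmegaY2 (n N : ℕ) (xd : Fin n → ℝ) (z : Knot N → ℝ) (u₂ : ℝ) (x : ℝ)
    (ε : Fin n → ℝ) : Prop :=
  ∀ q ∈ IcalPairs N z x,
    |ybar n xd ε (z q.1) (z q.2)| ≤
      u₂ * Real.sqrt (Real.log n / nIv n xd (z q.1) (z q.2))

/-- the local rate ε_n(x) = (n/log n)^{−t(x)/(2t(x)+1)} -/
def epsn (t : ℝ → ℝ) (n : ℕ) (x : ℝ) : ℝ :=
  ((n : ℝ) / Real.log n) ^ (-(t x) / (2 * t x + 1))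

/-- s_n(δ) = δ log n / ε_n² -/
def snD (t : ℝ → ℝ) (n : ℕ) (x : ℝ) (δ : ℝ) : ℝ :=
  δ * Real.log n / epsn t n x ^ 2

/-- the standard Gaussian on ℝ -/
def stdGaussian : Measure ℝ := ProbabilityTheory.gaussianReal 0 1

/-- the regression noise distribution -/
def regNoise (n : ℕ) : Measure (Fin n → ℝ) := Measure.pi fun _ => stdGaussian

/-- Assumption A4: the smoothness exponent t is piecewise Hölder -/
def A4 (t : ℝ → ℝ) : Prop :=
  ∃ k : ℕ, ∃ a : Fin (k + 2) → ℝ, a 0 = 0 ∧ a (Fin.last (k + 1)) = 1 ∧ StrictMono a ∧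
    ∃ L₀ > (0 : ℝ), ∀ j : Fin (k + 1), ∃ α > (0 : ℝ),
      (∀ x ∈ Set.Ioo (a j.castSucc) (a j.succ), ∀ y ∈ Set.Ioo (a j.castSucc) (a j.succ),
        |t x - t y| ≤ L₀ * |x - y| ^ α) ∧
      (∀ x ∈ Set.Ioo (a j.castSucc) (a j.succ),
        |t x - t (a j.castSucc)| ≤ L₀ * |x - a j.castSucc| ^ α ∧
        |t x - t (a j.succ)| ≤ L₀ * |x - a j.succ| ^ α)


section Gaussian

instance (n : ℕ) : IsProbabilityMeasure (regNoise n) := by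
  unfold regNoise stdGaussian; infer_instance

lemma iIndepFun_regNoise (n : ℕ) :
    iIndepFun (fun (i : Fin n) (ε : Fin n → ℝ) => ε i) (regNoise n) := by
  have := iIndepFun_pi (ι := Fin n) (𝓧 := fun _ => ℝ) (Ω := fun _ => ℝ)
    (μ := fun _ => gaussianReal 0 1) (X := fun _ x => x)
    (fun i => aemeasurable_id)
  exact this

lemma map_sum_regNoise (n : ℕ) (A : Finset (Fin n)) :
    (regNoise n).map (fun ε => ∑ i ∈ A, ε i) = gaussianReal 0 (A.card : ℝ≥0) := by
  induction A using Finset.induction_on with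
  | empty => simp
  | insert a A ha ih =>
    have h1 : (regNoise n).map (fun ε => ε a) = gaussianReal 0 1 :=
      (measurePreserving_eval (fun _ : Fin n => gaussianReal 0 1) a).map_eq
    have hind := (iIndepFun_regNoise n).indepFun_finsetSum_of_notMem
      (fun i => measurable_pi_apply i) ha
    have h2 := gaussianReal_add_gaussianReal_of_indepFun hind
      (m₁ := 0) (m₂ := 0) (v₁ := (A.card : ℝ≥0)) (v₂ := 1)
      (by rw [← ih]; congr 1; ext ε; simp) h1
    rw [Finset.card_insert_of_notMem ha]
    have : (fun ε : Fin n → ℝ => ∑ i ∈ insert a A, ε i)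
        = (∑ i ∈ A, fun ε : Fin n → ℝ => ε i) + fun ε => ε a := by
      ext ε; simp [Finset.sum_insert ha, add_comm]
    rw [this, h2]; simp

/-- The squared standardised noise `|A| ε̄_A²` over the design points in `A`. -/
def noiseSq {n : ℕ} (A : Finset (Fin n)) (ε : Fin n → ℝ) : ℝ := (∑ i ∈ A, ε i) ^ 2 / A.card

lemma gaussian_exp_sq {v : ℝ≥0} {s : ℝ} (hs0 : 0 ≤ s) (hs : s < 1 / 2) :
    Integrable (fun x : ℝ => Real.exp (s * (x ^ 2 / v))) (gaussianReal 0 v) ∧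
    ∫ x, Real.exp (s * (x ^ 2 / v)) ∂gaussianReal 0 v ≤ (1 - 2 * s)⁻¹ := by
  have hone : 1 ≤ (1 - 2 * s)⁻¹ := by
    rw [one_le_inv₀ (by linarith)]; linarith
  by_cases hv : v = 0
  · subst hv; simpa using hone
  have hv' : (0 : ℝ) < v := by positivity
  have key : ∀ x : ℝ, gaussianPDFReal 0 v x * Real.exp (s * (x ^ 2 / v)) =
      (√(2 * Real.pi * v))⁻¹ * Real.exp (-((1 - 2 * s) / (2 * v)) * x ^ 2) := by
    intro x
    rw [gaussianPDFReal, mul_assoc, ← Real.exp_add]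
    congr 2
    field_simp
    ring
  have hb : 0 < (1 - 2 * s) / (2 * v) := by
    apply div_pos <;> linarith
  constructor
  · rw [gaussianReal_of_var_ne_zero _ hv, integrable_withDensity_iff_integrable_smul'
      (measurable_gaussianPDF 0 v) (ae_of_all _ fun x => gaussianPDF_lt_top)]
    simp only [toReal_gaussianPDF, smul_eq_mul, key]
    exact (integrable_exp_neg_mul_sq hb).const_mul _
  · rw [integral_gaussianReal_eq_integral_smul hv]
    simp only [smul_eq_mul, key]
    rw [integral_const_mul, integral_gaussian, ← Real.sqrt_inv, ← Real.sqrt_mul (by positivity)]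
    have : (2 * Real.pi * (v : ℝ))⁻¹ * (Real.pi / ((1 - 2 * s) / (2 * v))) = (1 - 2 * s)⁻¹ := by
      have : (1 - 2 * s) ≠ 0 := by linarith
      field_simp
    rw [this]
    rw [Real.sqrt_le_left (by linarith)]
    nlinarith

lemma integral_exp_noiseSq {n : ℕ} (A : Finset (Fin n)) {s : ℝ} (hs0 : 0 ≤ s) (hs : s < 1 / 2) :
    Integrable (fun ε => Real.exp (s * noiseSq A ε)) (regNoise n) ∧
    ∫ ε, Real.exp (s * noiseSq A ε) ∂regNoise n ≤ (1 - 2 * s)⁻¹ := by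
  have h := gaussian_exp_sq (v := (A.card : ℝ≥0)) hs0 hs
  rw [← map_sum_regNoise n A] at h
  have hm : Measurable fun ε : Fin n → ℝ => ∑ i ∈ A, ε i := by fun_prop
  rw [integrable_map_measure (by fun_prop) hm.aemeasurable,
    integral_map hm.aemeasurable (by fun_prop)] at h
  exact h

lemma integral_exp_noiseSq_add {n : ℕ} {A A' : Finset (Fin n)} (hA : Disjoint A A') {s : ℝ}
    (hs0 : 0 ≤ s) (hs : s < 1 / 2) :
    Integrable (fun ε => Real.exp (s * (noiseSq A ε + noiseSq A' ε))) (regNoise n) ∧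
    ∫ ε, Real.exp (s * (noiseSq A ε + noiseSq A' ε)) ∂regNoise n ≤ (1 - 2 * s)⁻¹ ^ 2 := by
  have hind := (iIndepFun_regNoise n).indepFun_finset A A' hA (fun i => measurable_pi_apply i)
  let F : ∀ A : Finset (Fin n), (A → ℝ) → ℝ := fun A v =>
    Real.exp (s * ((∑ i, v i) ^ 2 / A.card))
  have hF : ∀ A, Measurable (F A) := fun A => by fun_prop
  have h2 := hind.comp (hF A) (hF A')
  have e : ∀ A : Finset (Fin n), (F A ∘ fun (ε : Fin n → ℝ) (i : A) => ε i)
      = fun ε => Real.exp (s * noiseSq A ε) := by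
    intro A; ext ε
    simp only [F, Function.comp, noiseSq]
    rw [← Finset.sum_coe_sort A]
  rw [e, e] at h2
  have i1 := integral_exp_noiseSq A hs0 hs
  have i2 := integral_exp_noiseSq A' hs0 hs
  have e2 : (fun ε => Real.exp (s * (noiseSq A ε + noiseSq A' ε))) =
      (fun ε => Real.exp (s * noiseSq A ε)) * fun ε => Real.exp (s * noiseSq A' ε) := by
    ext ε; simp [mul_add, Real.exp_add]
  rw [e2]
  refine ⟨h2.integrable_mul i1.1 i2.1, ?_⟩
  rw [h2.integral_mul_eq_mul_integral i1.1.aestronglyMeasurable i2.1.aestronglyMeasurable, sq]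
  have : 0 ≤ (1 - 2 * s)⁻¹ := by rw [inv_nonneg]; linarith
  exact mul_le_mul i1.2 i2.2 (integral_nonneg fun _ => (Real.exp_pos _).le) this

end Gaussian

section BlockMarginal

/-- The residual sum of squares over the design points in `A` for the constant fit `b`. -/
def ssq {n : ℕ} (Y : Fin n → ℝ) (A : Finset (Fin n)) (b : ℝ) : ℝ := ∑ i ∈ A, (Y i - b) ^ 2

/-- The average of `f` over `A`. -/
def avg {n : ℕ} (f : Fin n → ℝ) (A : Finset (Fin n)) : ℝ := (∑ i ∈ A, f i) / A.card

/-- The marginal likelihood of a block with design points `A` and coefficient density `γ`. -/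
def marg {n : ℕ} (γ : ℝ → ℝ) (Y : Fin n → ℝ) (A : Finset (Fin n)) : ℝ :=
  ∫ b, γ b * Real.exp (-(1 / 2) * ssq Y A b)

lemma ssq_nonneg {n : ℕ} (Y : Fin n → ℝ) (A : Finset (Fin n)) (b : ℝ) : 0 ≤ ssq Y A b :=
  Finset.sum_nonneg fun _ _ => sq_nonneg _

@[fun_prop]
lemma measurable_ssq {n : ℕ} (Y : Fin n → ℝ) (A : Finset (Fin n)) : Measurable (ssq Y A) := by
  unfold ssq; fun_prop

lemma ssq_expand {n : ℕ} (Y : Fin n → ℝ) (A : Finset (Fin n)) (v b : ℝ) :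
    ssq Y A b = ssq Y A v - 2 * (b - v) * ∑ i ∈ A, (Y i - v) + A.card * (b - v) ^ 2 := by
  unfold ssq
  rw [Finset.mul_sum, ← Finset.sum_sub_distrib, ← nsmul_eq_mul, ← Finset.sum_const,
    ← Finset.sum_add_distrib]
  exact Finset.sum_congr rfl fun i _ => by ring

lemma sum_sub_avg {n : ℕ} (f ε : Fin n → ℝ) (A : Finset (Fin n)) :
    ∑ i ∈ A, (f i + ε i - avg f A) = ∑ i ∈ A, ε i := by
  rcases A.eq_empty_or_nonempty with rfl | hA
  · simp
  have : (A.card : ℝ) ≠ 0 := by exact_mod_cast hA.card_pos.ne'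
  simp only [Finset.sum_sub_distrib, Finset.sum_add_distrib, Finset.sum_const, nsmul_eq_mul, avg]
  field_simp
  ring

lemma two_mul_noise_le {n : ℕ} (A : Finset (Fin n)) (ε : Fin n → ℝ) (d : ℝ) {τ : ℝ} (hτ : 0 < τ) :
    2 * d * ∑ i ∈ A, ε i ≤ τ * noiseSq A ε + τ⁻¹ * (A.card * d ^ 2) := by
  unfold noiseSq
  rcases A.eq_empty_or_nonempty with rfl | hA
  · simp
  have hc : (0 : ℝ) < A.card := by exact_mod_cast hA.card_pos
  set s := ∑ i ∈ A, ε i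
  have : τ * (s ^ 2 / A.card) + τ⁻¹ * (A.card * d ^ 2) - 2 * d * s
      = (τ * A.card)⁻¹ * (τ * s - A.card * d) ^ 2 := by
    field_simp
    ring
  have h2 : 0 ≤ (τ * A.card)⁻¹ * (τ * s - A.card * d) ^ 2 := by positivity
  linarith

lemma ssq_le_avg {n : ℕ} (f ε : Fin n → ℝ) (A : Finset (Fin n)) (v : ℝ) {τ : ℝ} (hτ : 0 < τ) :
    ssq (fun i => f i + ε i) A v ≤ ssq (fun i => f i + ε i) A (avg f A) +
      τ * noiseSq A ε + (1 + τ⁻¹) * (A.card * (v - avg f A) ^ 2) := by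
  rw [ssq_expand _ A (avg f A) v, sum_sub_avg]
  have := two_mul_noise_le A ε (-(v - avg f A)) hτ
  rw [neg_sq] at this
  linarith

lemma ssq_avg_le {n : ℕ} (f ε : Fin n → ℝ) (A : Finset (Fin n)) (b : ℝ) :
    ssq (fun i => f i + ε i) A (avg f A) + 1 / 2 * (A.card * (b - avg f A) ^ 2)
      - 2 * noiseSq A ε ≤ ssq (fun i => f i + ε i) A b := by
  rw [ssq_expand _ A (avg f A) b, sum_sub_avg]
  have := two_mul_noise_le A ε (b - avg f A) two_pos
  linarith

lemma ssq_avg_le' {n : ℕ} (f ε : Fin n → ℝ) (A : Finset (Fin n)) (b : ℝ) :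
    ssq (fun i => f i + ε i) A (avg f A) - noiseSq A ε ≤ ssq (fun i => f i + ε i) A b := by
  rw [ssq_expand _ A (avg f A) b, sum_sub_avg]
  have := two_mul_noise_le A ε (b - avg f A) one_pos
  linarith

lemma ssq_eq_mean {n : ℕ} (f ε : Fin n → ℝ) {A : Finset (Fin n)} (hA : A.Nonempty) (b : ℝ) :
    ssq (fun i => f i + ε i) A b = ssq (fun i => f i + ε i) A (avg f A) - noiseSq A ε +
      A.card * (b + -(avg f A + (∑ i ∈ A, ε i) / A.card)) ^ 2 := by
  rw [ssq_expand _ A (avg f A) b, sum_sub_avg, noiseSq]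
  have hc : (A.card : ℝ) ≠ 0 := by exact_mod_cast hA.card_pos.ne'
  field_simp
  ring

/-- A probability density bounded by `c₁`, and bounded below by `c₀` on `[-B₀, B₀]`. -/
structure IsGoodDensity (c₀ c₁ B₀ : ℝ) (γ : ℝ → ℝ) : Prop where
  lower : ∀ b : ℝ, |b| ≤ B₀ → c₀ ≤ γ b
  nonneg : ∀ b, 0 ≤ γ b
  upper : ∀ b, γ b ≤ c₁
  integral_eq : ∫ b, γ b = 1

variable {c₀ c₁ B₀ : ℝ} {γ : ℝ → ℝ}

lemma IsGoodDensity.integrable (h : IsGoodDensity c₀ c₁ B₀ γ) : Integrable γ := by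
  by_contra hn
  have := h.integral_eq
  rw [integral_undef hn] at this
  exact zero_ne_one this

lemma IsGoodDensity.integrable_mul (h : IsGoodDensity c₀ c₁ B₀ γ) {ψ : ℝ → ℝ} (hψ : Measurable ψ)
    (h0 : ∀ b, 0 ≤ ψ b) (h1 : ∀ b, ψ b ≤ 1) : Integrable fun b => γ b * ψ b := by
  refine h.integrable.mul_bdd (c := 1) hψ.aestronglyMeasurable (ae_of_all _ fun b => ?_)
  rw [Real.norm_of_nonneg (h0 b)]; exact h1 b

lemma exp_ssq_le_one {n : ℕ} (Y : Fin n → ℝ) (A : Finset (Fin n)) (b : ℝ) :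
    Real.exp (-(1 / 2) * ssq Y A b) ≤ 1 := by
  have := ssq_nonneg Y A b
  rw [Real.exp_le_one_iff]; linarith

lemma IsGoodDensity.integrable_marg (h : IsGoodDensity c₀ c₁ B₀ γ) {n : ℕ} (Y : Fin n → ℝ)
    (A : Finset (Fin n)) : Integrable fun b => γ b * Real.exp (-(1 / 2) * ssq Y A b) :=
  h.integrable_mul (by fun_prop) (fun _ => (Real.exp_pos _).le) (exp_ssq_le_one Y A)

lemma marg_lower (h : IsGoodDensity c₀ c₁ B₀ γ) {n : ℕ} (Y : Fin n → ℝ)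
    (A : Finset (Fin n)) {v ρ : ℝ} (hρ : 0 < ρ) (hρ1 : ρ ≤ 1) (hv : |v| + ρ ≤ B₀) :
    c₀ * ρ * Real.exp (-(1 / 2)) * (√(A.card + 1))⁻¹ * Real.exp (-(1 / 2) * ssq Y A v)
      ≤ marg γ Y A := by
  set r := ρ * (√((A.card : ℝ) + 1))⁻¹ with hr
  have hA0 : (0 : ℝ) ≤ A.card := Nat.cast_nonneg _
  have hs1 : 1 ≤ √((A.card : ℝ) + 1) := by rw [Real.one_le_sqrt]; linarith
  have hinv : (√((A.card : ℝ) + 1))⁻¹ ≤ 1 := inv_le_one_of_one_le₀ hs1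
  have hr0 : 0 ≤ r := by positivity
  have hrρ : r ≤ ρ := mul_le_of_le_one_right hρ.le hinv
  have hAr : A.card * r ^ 2 ≤ 1 := by
    rw [hr, mul_pow, inv_pow, Real.sq_sqrt (by linarith)]
    have h1 : ρ ^ 2 ≤ 1 := by nlinarith
    have h2 : (A.card : ℝ) * ((A.card : ℝ) + 1)⁻¹ ≤ 1 := by
      rw [← div_eq_mul_inv, div_le_one (by linarith)]; linarith
    have h3 : 0 ≤ (A.card : ℝ) * ((A.card : ℝ) + 1)⁻¹ := by positivity
    nlinarith
  have hv1 := abs_le.1 (show |v| ≤ |v| from le_rfl)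
  have main : ∀ T : Set ℝ, MeasurableSet T → volume T = ENNReal.ofReal r →
      (∀ b ∈ T, |b - v| ≤ r ∧ 0 ≤ (b - v) * ∑ i ∈ A, (Y i - v)) →
      c₀ * ρ * Real.exp (-(1 / 2)) * (√(A.card + 1))⁻¹ * Real.exp (-(1 / 2) * ssq Y A v)
        ≤ marg γ Y A := by
    intro T hT hvol hb
    have e1 : c₀ * ρ * Real.exp (-(1 / 2)) * (√(A.card + 1))⁻¹ * Real.exp (-(1 / 2) * ssq Y A v)
        = ∫ b in T, c₀ * (Real.exp (-(1 / 2)) * Real.exp (-(1 / 2) * ssq Y A v)) := by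
      rw [setIntegral_const, Measure.real, hvol, ENNReal.toReal_ofReal hr0, smul_eq_mul, hr]
      ring
    rw [e1]
    have hint := h.integrable_marg Y A
    calc _ ≤ ∫ b in T, γ b * Real.exp (-(1 / 2) * ssq Y A b) := by
          refine setIntegral_mono_on ?_ hint.integrableOn hT fun b hbT => ?_
          · apply integrableOn_const (by rw [hvol]; exact ENNReal.ofReal_ne_top)
          obtain ⟨hb1, hb2⟩ := hb b hbT
          have hbB : |b| ≤ B₀ := by
            have : |b| ≤ |b - v| + |v| := by simpa using abs_add_le (b - v) v
            linarith
          refine mul_le_mul (h.lower b hbB) ?_ (by positivity) (h.nonneg b)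
          rw [← Real.exp_add, Real.exp_le_exp, ssq_expand Y A v b]
          have : (b - v) ^ 2 ≤ r ^ 2 := by rw [← sq_abs]; gcongr
          nlinarith [mul_le_mul_of_nonneg_left this hA0]
      _ ≤ marg γ Y A := setIntegral_le_integral hint
          (ae_of_all _ fun b => mul_nonneg (h.nonneg b) (Real.exp_pos _).le)
  rcases le_total 0 (∑ i ∈ A, (Y i - v)) with hs | hs
  · refine main (Icc v (v + r)) measurableSet_Icc (by simp) fun b hb => ⟨?_, ?_⟩
    · rw [abs_of_nonneg (by linarith [hb.1])]; linarith [hb.2]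
    · exact mul_nonneg (by linarith [hb.1]) hs
  · refine main (Icc (v - r) v) measurableSet_Icc (by simp) fun b hb => ⟨?_, ?_⟩
    · rw [abs_of_nonpos (by linarith [hb.2])]; linarith [hb.1]
    · exact mul_nonneg_of_nonpos_of_nonpos (by linarith [hb.2]) hs

lemma integral_mul_le {ψ : ℝ → ℝ} (h : IsGoodDensity c₀ c₁ B₀ γ) (hψ : ∀ b, 0 ≤ ψ b) {K : ℝ}
    (hK : ∀ b, ψ b ≤ K) : ∫ b, γ b * ψ b ≤ K := by
  calc _ ≤ ∫ b, γ b * K := integral_mono_of_nonneg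
        (ae_of_all _ fun b => mul_nonneg (h.nonneg b) (hψ b)) (h.integrable.mul_const _)
        (ae_of_all _ fun b => mul_le_mul_of_nonneg_left (hK b) (h.nonneg b))
    _ = K := by rw [integral_mul_const, h.integral_eq, one_mul]

lemma marg_le (h : IsGoodDensity c₀ c₁ B₀ γ) {n : ℕ} (f ε : Fin n → ℝ) (A : Finset (Fin n)) :
    marg γ (fun i => f i + ε i) A ≤
      Real.exp (-(1 / 2) * (ssq (fun i => f i + ε i) A (avg f A) - noiseSq A ε)) := by
  refine integral_mul_le h (fun b => (Real.exp_pos _).le) fun b => ?_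
  rw [Real.exp_le_exp]
  linarith [ssq_avg_le' f ε A b]

lemma marg_le_sqrt (h : IsGoodDensity c₀ c₁ B₀ γ) (hc₁ : 0 ≤ c₁) {n : ℕ} (f ε : Fin n → ℝ)
    (A : Finset (Fin n)) :
    marg γ (fun i => f i + ε i) A ≤ (1 + c₁ * √(4 * Real.pi)) * (√(A.card + 1))⁻¹ *
      Real.exp (-(1 / 2) * (ssq (fun i => f i + ε i) A (avg f A) - noiseSq A ε)) := by
  rcases A.eq_empty_or_nonempty with rfl | hA
  · refine (marg_le h f ε ∅).trans ?_
    have : 0 ≤ c₁ * √(4 * Real.pi) := by positivity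
    simp only [Finset.card_empty, Nat.cast_zero, zero_add, Real.sqrt_one, inv_one, mul_one]
    exact le_mul_of_one_le_left (Real.exp_pos _).le (by linarith)
  have hc : (1 : ℝ) ≤ A.card := by exact_mod_cast hA.card_pos
  set E := Real.exp (-(1 / 2) * (ssq (fun i => f i + ε i) A (avg f A) - noiseSq A ε))
  set m := avg f A + (∑ i ∈ A, ε i) / A.card
  have hE : ∀ b, Real.exp (-(1 / 2) * ssq (fun i => f i + ε i) A b)
      = E * Real.exp (-(A.card / 2 : ℝ) * (b + -m) ^ 2) := by
    intro b
    rw [ssq_eq_mean f ε hA b, ← Real.exp_add]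
    congr 1; ring
  have hi : Integrable fun b : ℝ => c₁ * (E * Real.exp (-(A.card / 2 : ℝ) * (b + -m) ^ 2)) :=
    (((integrable_exp_neg_mul_sq (b := (A.card / 2 : ℝ)) (by positivity)).comp_add_right
      (-m)).const_mul E).const_mul c₁
  calc marg γ (fun i => f i + ε i) A
      ≤ ∫ b : ℝ, c₁ * (E * Real.exp (-(A.card / 2 : ℝ) * (b + -m) ^ 2)) := by
        refine integral_mono (h.integrable_marg _ A) hi fun b => ?_
        simp only [hE]
        exact mul_le_mul_of_nonneg_right (h.upper b) (by positivity)
    _ = c₁ * √(Real.pi / (A.card / 2)) * E := by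
        rw [integral_const_mul, integral_const_mul,
          integral_add_right_eq_self (fun b : ℝ => Real.exp (-(A.card / 2 : ℝ) * b ^ 2)) (-m),
          integral_gaussian]
        ring
    _ ≤ (1 + c₁ * √(4 * Real.pi)) * (√(A.card + 1))⁻¹ * E := by
        refine mul_le_mul_of_nonneg_right ?_ (Real.exp_pos _).le
        have : √(Real.pi / (A.card / 2)) ≤ √(4 * Real.pi) * (√((A.card : ℝ) + 1))⁻¹ := by
          rw [← Real.sqrt_inv, ← Real.sqrt_mul (by positivity)]
          apply Real.sqrt_le_sqrt
          rw [← div_eq_mul_inv, div_le_div_iff₀ (by positivity) (by positivity)]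
          nlinarith [Real.pi_pos]
        have h2 : 0 ≤ (√((A.card : ℝ) + 1))⁻¹ := by positivity
        nlinarith [mul_le_mul_of_nonneg_left this hc₁]

end BlockMarginal

section Partitions

variable {N : ℕ} {z : Knot N → ℝ} {S : Finset (Knot N)}

/-- The consecutive pairs of knots of `S`, i.e. the blocks of the partition. -/
def blocks (S : Finset (Knot N)) : Finset (Knot N × Knot N) :=
  Finset.univ.filter fun q => Consec N S q.1 q.2

lemma mem_blocks {q : Knot N × Knot N} : q ∈ blocks S ↔ Consec N S q.1 q.2 := by
  simp [blocks]

lemma exists_block (h0 : z 0 = 0) (h1 : z (Fin.last N) = 1)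
    (hS : IsPart N S) {x : ℝ} (hx : x ∈ Ioc (0 : ℝ) 1) :
    ∃ i j, Consec N S i j ∧ x ∈ Ioc (z i) (z j) := by
  have hA : (S.filter fun m => z m < x).Nonempty :=
    ⟨0, by simp [hS.1, h0, hx.1]⟩
  set i := (S.filter fun m => z m < x).max' hA with hi
  have hi1 := Finset.max'_mem _ hA
  rw [← hi, Finset.mem_filter] at hi1
  have hB : (S.filter fun m => i < m).Nonempty := by
    refine ⟨Fin.last N, ?_⟩
    rw [Finset.mem_filter]
    refine ⟨hS.2, lt_of_le_of_ne (Fin.le_last _) fun h => ?_⟩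
    rw [h, h1] at hi1
    exact absurd hi1.2 (not_lt.2 hx.2)
  set j := (S.filter fun m => i < m).min' hB with hj
  have hj1 := Finset.min'_mem _ hB
  rw [← hj, Finset.mem_filter] at hj1
  refine ⟨i, j, ⟨hi1.1, hj1.1, hj1.2, fun m hm hmm => ?_⟩, hi1.2, ?_⟩
  · exact absurd (Finset.min'_le _ m (Finset.mem_filter.2 ⟨hm, hmm.1⟩)) (not_le.2 hmm.2)
  · by_contra hlt
    have hjf : j ∈ S.filter fun m => z m < x := Finset.mem_filter.2 ⟨hj1.1, not_le.1 hlt⟩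
    have hji : j ≤ i := Finset.le_max' _ j hjf
    exact absurd hj1.2 (not_lt.2 hji)

lemma consec_eq_of_lt {i j i' j' : Knot N} (h : Consec N S i j) (h' : Consec N S i' j')
    (h1 : i < j') (h2 : i' < j) : i = i' ∧ j = j' := by
  obtain ⟨hi, hj, -, hb⟩ := h
  obtain ⟨hi', hj', -, hb'⟩ := h'
  constructor
  · rcases lt_trichotomy i i' with hlt | he | hlt
    · exact absurd ⟨hlt, h2⟩ (hb _ hi')
    · exact he
    · exact absurd ⟨hlt, h1⟩ (hb' _ hi)
  · rcases lt_trichotomy j j' with hlt | he | hlt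
    · exact absurd ⟨h2, hlt⟩ (hb' _ hj)
    · exact he
    · exact absurd ⟨h1, hlt⟩ (hb _ hj')

lemma block_unique (hz : StrictMono z) {i j i' j' : Knot N} (h : Consec N S i j)
    (h' : Consec N S i' j') {x : ℝ} (hx : x ∈ Ioc (z i) (z j)) (hx' : x ∈ Ioc (z i') (z j')) :
    i = i' ∧ j = j' :=
  consec_eq_of_lt h h' (hz.lt_iff_lt.1 (hx.1.trans_le hx'.2)) (hz.lt_iff_lt.1 (hx'.1.trans_le hx.2))

lemma prod_blocks_eq (hz : StrictMono z) (h0 : z 0 = 0) (h1 : z (Fin.last N) = 1)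
    (hS : IsPart N S) (F : Knot N × Knot N → ℝ) (G : Knot N → ℝ)
    (hFG : ∀ i j, Consec N S i j → F (i, j) = G j) :
    ∏ q ∈ blocks S, F q = ∏ j ∈ S.erase 0, G j := by
  refine Finset.prod_bij (fun q _ => q.2) ?_ ?_ ?_ ?_
  · intro q hq
    have := mem_blocks.1 hq
    exact Finset.mem_erase.2 ⟨(Fin.pos_of_ne_zero (ne_of_gt ((Fin.zero_le _).trans_lt this.2.2.1))).ne',
      this.2.1⟩
  · intro q hq q' hq' he
    have h := mem_blocks.1 hq
    have h' := mem_blocks.1 hq'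
    have := consec_eq_of_lt h h' (he ▸ h.2.2.1) (he ▸ h'.2.2.1)
    exact Prod.ext this.1 this.2
  · intro j hj
    obtain ⟨hj0, hjS⟩ := Finset.mem_erase.1 hj
    have hzj : z j ∈ Ioc (0 : ℝ) 1 := by
      rw [← h0, ← h1]
      exact ⟨hz (Fin.pos_of_ne_zero hj0), hz.monotone (Fin.le_last _)⟩
    obtain ⟨i, k, hik, hx⟩ := exists_block h0 h1 hS hzj
    have hjk : j ≤ k := hz.le_iff_le.1 hx.2
    have hij : i < j := hz.lt_iff_lt.1 hx.1
    have : j = k := by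
      by_contra hne
      exact hik.2.2.2 j hjS ⟨hij, lt_of_le_of_ne hjk hne⟩
    exact ⟨(i, k), mem_blocks.2 hik, this.symm⟩
  · intro q hq
    exact hFG _ _ (mem_blocks.1 hq)

lemma consec_insert {i j k : Knot N} (h : Consec N S i k) (hij : i < j) (hjk : j < k) :
    Consec N (insert j S) i j ∧ Consec N (insert j S) j k := by
  obtain ⟨hi, hk, -, hb⟩ := h
  refine ⟨⟨Finset.mem_insert_of_mem hi, Finset.mem_insert_self _ _, hij, fun m hm hmm => ?_⟩,
    ⟨Finset.mem_insert_self _ _, Finset.mem_insert_of_mem hk, hjk, fun m hm hmm => ?_⟩⟩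
  · rcases Finset.mem_insert.1 hm with rfl | hm
    · exact lt_irrefl _ hmm.2
    · exact hb m hm ⟨hmm.1, hmm.2.trans hjk⟩
  · rcases Finset.mem_insert.1 hm with rfl | hm
    · exact lt_irrefl _ hmm.1
    · exact hb m hm ⟨hij.trans hmm.1, hmm.2⟩

lemma consec_erase {i j k : Knot N} (h : Consec N S i j) (h' : Consec N S j k) :
    Consec N (S.erase j) i k := by
  refine ⟨Finset.mem_erase.2 ⟨h.2.2.1.ne, h.1⟩, Finset.mem_erase.2 ⟨h'.2.2.1.ne', h'.2.1⟩,
    h.2.2.1.trans h'.2.2.1, fun m hm hmm => ?_⟩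
  obtain ⟨hmj, hmS⟩ := Finset.mem_erase.1 hm
  rcases lt_or_gt_of_ne hmj with hlt | hlt
  · exact h.2.2.2 m hmS ⟨hmm.1, hlt⟩
  · exact h'.2.2.2 m hmS ⟨hlt, hmm.2⟩

lemma blocks_insert {i j k : Knot N} (h : Consec N S i k) (hij : i < j) (hjk : j < k) :
    blocks (insert j S) = insert (i, j) (insert (j, k) ((blocks S).erase (i, k))) := by
  have hins := consec_insert h hij hjk
  have hjS : j ∉ S := fun hj => h.2.2.2 j hj ⟨hij, hjk⟩
  ext ⟨a, b⟩
  simp only [Finset.mem_insert, Finset.mem_erase, mem_blocks, Prod.mk.injEq, ne_eq]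
  constructor
  · intro hab
    by_cases ha : a = j
    · right; left
      exact ⟨ha, (consec_eq_of_lt hab hins.2 (ha ▸ hjk) (ha ▸ hab.2.2.1)).2⟩
    by_cases hb : b = j
    · left
      exact ⟨(consec_eq_of_lt hab hins.1 (hb ▸ hab.2.2.1) (hb ▸ hij)).1, hb⟩
    have haS := Finset.mem_of_mem_insert_of_ne hab.1 ha
    have hbS := Finset.mem_of_mem_insert_of_ne hab.2.1 hb
    right; right
    refine ⟨fun he => ?_, haS, hbS, hab.2.2.1, fun m hm => hab.2.2.2 m (Finset.mem_insert_of_mem hm)⟩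
    exact hab.2.2.2 j (Finset.mem_insert_self _ _) (by rw [he.1, he.2]; exact ⟨hij, hjk⟩)
  · rintro (⟨rfl, rfl⟩ | ⟨rfl, rfl⟩ | ⟨hne, hab⟩)
    · exact hins.1
    · exact hins.2
    · refine ⟨Finset.mem_insert_of_mem hab.1, Finset.mem_insert_of_mem hab.2.1, hab.2.2.1,
        fun m hm hmm => ?_⟩
      rcases Finset.mem_insert.1 hm with rfl | hm
      · exact hne (consec_eq_of_lt hab h (hmm.1.trans hjk) (hij.trans hmm.2))
      · exact hab.2.2.2 m hm hmm

lemma notMem_blocks_of_notMem {a b : Knot N} (h : a ∉ S ∨ b ∉ S) : (a, b) ∉ blocks S := by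
  intro hm
  have := mem_blocks.1 hm
  exact h.elim (fun h => h this.1) (fun h => h this.2.1)

lemma prod_blocks_insert {i j k : Knot N} (h : Consec N S i k) (hij : i < j) (hjk : j < k)
    (φ : Knot N × Knot N → ℝ) :
    ∏ q ∈ blocks (insert j S), φ q =
      φ (i, j) * φ (j, k) * ∏ q ∈ (blocks S).erase (i, k), φ q := by
  have hjS : j ∉ S := fun hj => h.2.2.2 j hj ⟨hij, hjk⟩
  rw [blocks_insert h hij hjk, Finset.prod_insert, Finset.prod_insert, mul_assoc]
  · exact fun hm => notMem_blocks_of_notMem (Or.inl hjS) (Finset.mem_of_mem_erase hm)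
  · rw [Finset.mem_insert, not_or]
    refine ⟨fun he => hij.ne (Prod.ext_iff.1 he).1, fun hm => ?_⟩
    exact notMem_blocks_of_notMem (Or.inr hjS) (Finset.mem_of_mem_erase hm)

lemma prod_blocks_insert_erase {i j k : Knot N} (h : Consec N S i k) (hij : i < j) (hjk : j < k)
    (φ : Knot N × Knot N → ℝ) :
    ∏ q ∈ (blocks (insert j S)).erase (j, k), φ q =
      φ (i, j) * ∏ q ∈ (blocks S).erase (i, k), φ q := by
  have hjS : j ∉ S := fun hj => h.2.2.2 j hj ⟨hij, hjk⟩
  have hne : (i, j) ≠ (j, k) := fun he => hij.ne (Prod.ext_iff.1 he).1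
  rw [blocks_insert h hij hjk, Finset.erase_insert_of_ne hne, Finset.erase_insert,
    Finset.prod_insert]
  · exact fun hm => notMem_blocks_of_notMem (Or.inr hjS) (Finset.mem_of_mem_erase hm)
  · exact fun hm => notMem_blocks_of_notMem (Or.inl hjS) (Finset.mem_of_mem_erase hm)

/-- `φ` on nondegenerate pairs and `1` on pairs `(a, b)` with `b ≤ a`. -/
def extOne (φ : Knot N × Knot N → ℝ) (a b : Knot N) : ℝ := if a < b then φ (a, b) else 1

lemma prod_blocks_insert_insert {i k a b : Knot N} (h : Consec N S i k) (hia : i ≤ a) (hab : a < b)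
    (hbk : b ≤ k) (φ : Knot N × Knot N → ℝ) :
    ∏ q ∈ blocks (insert b (insert a S)), φ q =
      extOne φ i a * φ (a, b) * extOne φ b k * ∏ q ∈ (blocks S).erase (i, k), φ q := by
  have hak := hab.trans_le hbk
  obtain ⟨hc, he⟩ : Consec N (insert a S) a k ∧ ∏ q ∈ (blocks (insert a S)).erase (a, k), φ q =
      extOne φ i a * ∏ q ∈ (blocks S).erase (i, k), φ q := by
    rcases hia.eq_or_lt with rfl | hlt
    · rw [Finset.insert_eq_of_mem h.1]
      exact ⟨h, by simp [extOne]⟩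
    · exact ⟨(consec_insert h hlt hak).2, by
        rw [prod_blocks_insert_erase h hlt hak, extOne, if_pos hlt]⟩
  rcases hbk.eq_or_lt with rfl | hlt
  · rw [Finset.insert_eq_of_mem hc.2.1, ← Finset.mul_prod_erase _ _ (mem_blocks (q := (a, b)).2 hc), he]
    simp only [extOne, lt_irrefl, if_false]
    ring
  · rw [prod_blocks_insert hc hab hlt, he]
    simp only [extOne, if_pos hlt]
    ring

end Partitions

section Factorisation

variable {n N : ℕ} {z : Knot N → ℝ} {S : Finset (Knot N)} {xd : Fin n → ℝ}
  {g : Knot N → ℝ → ℝ} {c₀ c₁ B₀ : ℝ}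

/-- The extension by zero used to define `partCondPrior`. -/
def extendZero (S : Finset (Knot N)) (v : {i : Knot N // i ∈ S.erase 0} → ℝ) : Knot N → ℝ :=
  fun i => if h : i ∈ S.erase 0 then v ⟨i, h⟩ else 0

lemma measurable_extendZero (S : Finset (Knot N)) : Measurable (extendZero S) := by
  refine measurable_pi_iff.2 fun i => ?_
  by_cases h : i ∈ S.erase 0
  · simp only [extendZero, h, dite_true]; fun_prop
  · simp only [extendZero, h, dite_false]; fun_prop

lemma integrable_prod_density (hg : ∀ j, IsGoodDensity c₀ c₁ B₀ (g j)) (S : Finset (Knot N)) :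
    Integrable (fun v : {i : Knot N // i ∈ S.erase 0} → ℝ => ∏ i, g i.1 (v i)) :=
  Integrable.fintype_prod_dep (f := fun (i : {i : Knot N // i ∈ S.erase 0}) => g i.1)
    fun i => (hg i.1).integrable

lemma isFiniteMeasure_partCondPrior (hg : ∀ j, IsGoodDensity c₀ c₁ B₀ (g j))
    (S : Finset (Knot N)) : IsFiniteMeasure (partCondPrior N g S) := by
  have := isFiniteMeasure_withDensity_ofReal (integrable_prod_density hg S).2
  unfold partCondPrior
  infer_instance

lemma integral_prod_partCondPrior (hg : ∀ j, IsGoodDensity c₀ c₁ B₀ (g j))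
    (ψ : Knot N → ℝ → ℝ) (hψ : ∀ j, Measurable (ψ j)) :
    ∫ β, ∏ j ∈ S.erase 0, ψ j (β j) ∂partCondPrior N g S =
      ∏ j ∈ S.erase 0, ∫ b, g j b * ψ j b := by
  have hmeas : Measurable fun β : Knot N → ℝ => ∏ j ∈ S.erase 0, ψ j (β j) :=
    Finset.measurable_fun_prod _ fun j _ => (hψ j).comp (measurable_pi_apply j)
  change ∫ β, _ ∂(Measure.map (extendZero S) _) = _
  rw [integral_map (measurable_extendZero S).aemeasurable hmeas.aestronglyMeasurable,
    integral_withDensity_eq_integral_toReal_smul₀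
      (integrable_prod_density hg S).1.aemeasurable.ennreal_ofReal
      (ae_of_all _ fun _ => ENNReal.ofReal_lt_top)]
  rw [← Finset.prod_coe_sort (S.erase 0)]
  rw [← integral_fintype_prod_volume_eq_prod
    (fun (i : {i : Knot N // i ∈ S.erase 0}) b => g i.1 b * ψ i.1 b)]
  refine integral_congr_ae (ae_of_all _ fun v => ?_)
  simp only
  rw [ENNReal.toReal_ofReal (Finset.prod_nonneg fun i _ => (hg i.1).nonneg _), smul_eq_mul,
    ← Finset.prod_coe_sort (S.erase 0), ← Finset.prod_mul_distrib]
  refine Finset.prod_congr rfl fun i _ => ?_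
  simp only [extendZero, i.2, dite_true, Subtype.coe_eta]

lemma integral_blocks_partCondPrior (hz : StrictMono z) (h0 : z 0 = 0) (h1 : z (Fin.last N) = 1)
    (hS : IsPart N S) (hg : ∀ j, IsGoodDensity c₀ c₁ B₀ (g j))
    (Ψ : Knot N × Knot N → ℝ → ℝ) (hΨ : ∀ q, Measurable (Ψ q)) :
    ∫ β, ∏ q ∈ blocks S, Ψ q (β q.2) ∂partCondPrior N g S =
      ∏ q ∈ blocks S, ∫ b, g q.2 b * Ψ q b := by
  set ψ : Knot N → ℝ → ℝ := fun j =>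
    if h : ∃ i, Consec N S i j then Ψ (h.choose, j) else 1 with hψdef
  have hψ : ∀ i j, Consec N S i j → Ψ (i, j) = ψ j := by
    intro i j hij
    have hex : ∃ i, Consec N S i j := ⟨i, hij⟩
    have he := (consec_eq_of_lt hij hex.choose_spec hij.2.2.1 hex.choose_spec.2.2.1).1
    simp only [hψdef, dif_pos hex]
    rw [← he]
  have hmeas : ∀ j, Measurable (ψ j) := by
    intro j
    by_cases hex : ∃ i, Consec N S i j
    · simp only [hψdef, dif_pos hex]; exact hΨ _
    · simp only [hψdef, dif_neg hex]; exact measurable_const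
  rw [prod_blocks_eq hz h0 h1 hS (fun q => ∫ b, g q.2 b * Ψ q b) (fun j => ∫ b, g j b * ψ j b)
    (fun i j hij => by simp only [hψ i j hij]), ← integral_prod_partCondPrior hg ψ hmeas]
  congr 1
  ext β
  exact prod_blocks_eq hz h0 h1 hS _ (fun j => ψ j (β j)) (fun i j hij => by simp only [hψ i j hij])

/-- The indices of the design points in the block `q`. -/
def pts (xd : Fin n → ℝ) (z : Knot N → ℝ) (q : Knot N × Knot N) : Finset (Fin n) :=
  Finset.univ.filter fun i => xd i ∈ Ioc (z q.1) (z q.2)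

lemma mem_pts {q : Knot N × Knot N} {i : Fin n} : i ∈ pts xd z q ↔ xd i ∈ Ioc (z q.1) (z q.2) := by
  simp [pts]

lemma fPart_eq (hz : StrictMono z) (β : Knot N → ℝ) {i j : Knot N} (h : Consec N S i j) {x : ℝ}
    (hx : x ∈ Ioc (z i) (z j)) : fPart N z S β x = β j := by
  unfold fPart
  rw [Finset.sum_eq_single j, Finset.sum_eq_single i, if_pos ⟨h, hx⟩]
  · intro i' _ hne
    exact if_neg fun h' => hne (block_unique hz h'.1 h h'.2 hx).1
  · simp
  · intro j' _ hne
    exact Finset.sum_eq_zero fun i' _ => if_neg fun h' => hne (block_unique hz h'.1 h h'.2 hx).2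
  · simp

lemma fPart_eq_zero (hz : StrictMono z) (h0 : z 0 = 0) (h1 : z (Fin.last N) = 1) (β : Knot N → ℝ)
    {x : ℝ} (hx : x ∉ Ioc (0 : ℝ) 1) : fPart N z S β x = 0 := by
  unfold fPart
  refine Finset.sum_eq_zero fun j _ => Finset.sum_eq_zero fun i _ => if_neg fun h => hx ?_
  rw [← h0, ← h1]
  exact ⟨(hz.monotone (Fin.zero_le _)).trans_lt h.2.1, h.2.2.trans (hz.monotone (Fin.le_last _))⟩

/-- The likelihood factor of the design points outside `(0, 1]`. -/
def outerFactor (xd : Fin n → ℝ) (Y : Fin n → ℝ) : ℝ :=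
  Real.exp (-(1 / 2) * ∑ i ∈ Finset.univ.filter fun i => xd i ∉ Ioc (0 : ℝ) 1, Y i ^ 2)

lemma exp_partLoglik (hz : StrictMono z) (h0 : z 0 = 0) (h1 : z (Fin.last N) = 1)
    (hS : IsPart N S) (Y : Fin n → ℝ) (β : Knot N → ℝ) :
    Real.exp (partLoglik n N z xd Y S β) = outerFactor xd Y *
      ∏ q ∈ blocks S, Real.exp (-(1 / 2) * ssq Y (pts xd z q) (β q.2)) := by
  rw [outerFactor, ← Real.exp_sum, ← Real.exp_add, partLoglik, ← Finset.mul_sum, ← mul_add]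
  congr 2
  simp only [ssq, pts, Finset.sum_filter]
  rw [Finset.sum_comm, ← Finset.sum_add_distrib]
  refine Finset.sum_congr rfl fun l _ => ?_
  by_cases hl : xd l ∈ Ioc (0 : ℝ) 1
  · obtain ⟨i, j, hij, hx⟩ := exists_block h0 h1 hS hl
    rw [if_neg (not_not.2 hl), fPart_eq hz β hij hx, zero_add,
      Finset.sum_eq_single_of_mem (i, j) (mem_blocks.2 hij)]
    · rw [if_pos hx]
    · intro q hq hne
      exact if_neg fun hx' => hne (Prod.ext_iff.2 (block_unique hz (mem_blocks.1 hq) hij hx' hx))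
  · rw [if_pos hl, fPart_eq_zero hz h0 h1 β hl, sub_zero, Finset.sum_eq_zero, add_zero]
    intro q _
    refine if_neg fun hx => hl ?_
    rw [← h0, ← h1]
    exact ⟨(hz.monotone (Fin.zero_le _)).trans_lt hx.1, hx.2.trans (hz.monotone (Fin.le_last _))⟩

/-- The contribution of the block `q` to the unnormalised posterior mass. -/
def blockMass (xd : Fin n → ℝ) (z : Knot N → ℝ) (B : ℝ) (g : Knot N → ℝ → ℝ) (Y : Fin n → ℝ)
    (q : Knot N × Knot N) : ℝ :=
  (z q.2 - z q.1) ^ B * marg (g q.2) Y (pts xd z q)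

/-- The unnormalised posterior mass of the partition `S`. -/
def mass (xd : Fin n → ℝ) (z : Knot N → ℝ) (B : ℝ) (g : Knot N → ℝ → ℝ) (Y : Fin n → ℝ)
    (S : Finset (Knot N)) : ℝ :=
  partWeight N z B S * ∫ β, Real.exp (partLoglik n N z xd Y S β) ∂partCondPrior N g S

lemma mass_eq (hz : StrictMono z) (h0 : z 0 = 0) (h1 : z (Fin.last N) = 1)
    (hS : IsPart N S) (hg : ∀ j, IsGoodDensity c₀ c₁ B₀ (g j)) (B : ℝ) (Y : Fin n → ℝ) :
    mass xd z B g Y S = outerFactor xd Y * ∏ q ∈ blocks S, blockMass xd z B g Y q := by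
  unfold mass
  simp only [exp_partLoglik hz h0 h1 hS]
  rw [integral_const_mul, integral_blocks_partCondPrior hz h0 h1 hS hg
    (fun q b => Real.exp (-(1 / 2) * ssq Y (pts xd z q) b)) (fun q => by fun_prop)]
  simp only [partWeight, if_pos hS, blockMass, Finset.prod_mul_distrib]
  change (∏ q ∈ blocks S, _) * _ = _
  simp only [marg]
  ring

/-- The unnormalised posterior mass of the partition `S` with the coefficient at the right
knot `k` restricted to `T`. -/
def massOn (xd : Fin n → ℝ) (z : Knot N → ℝ) (B : ℝ) (g : Knot N → ℝ → ℝ) (Y : Fin n → ℝ)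
    (k : Knot N) (T : Set ℝ) (S : Finset (Knot N)) : ℝ :=
  partWeight N z B S * ∫ β, (if β k ∈ T then (1 : ℝ) else 0) *
    Real.exp (partLoglik n N z xd Y S β) ∂partCondPrior N g S

lemma massOn_eq (hz : StrictMono z) (h0 : z 0 = 0) (h1 : z (Fin.last N) = 1)
    (hS : IsPart N S) (hg : ∀ j, IsGoodDensity c₀ c₁ B₀ (g j)) (B : ℝ) (Y : Fin n → ℝ)
    {i k : Knot N} (hik : Consec N S i k) {T : Set ℝ} (hT : MeasurableSet T) :
    massOn xd z B g Y k T S = outerFactor xd Y *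
      (((z k - z i) ^ B * ∫ b, g k b * ((if b ∈ T then (1 : ℝ) else 0) *
        Real.exp (-(1 / 2) * ssq Y (pts xd z (i, k)) b))) *
        ∏ q ∈ (blocks S).erase (i, k), blockMass xd z B g Y q) := by
  have hmem : (i, k) ∈ blocks S := mem_blocks.2 hik
  set Ψ : Knot N × Knot N → ℝ → ℝ := fun q b => (if q = (i, k) then
    (if b ∈ T then (1 : ℝ) else 0) else 1) * Real.exp (-(1 / 2) * ssq Y (pts xd z q) b) with hΨ
  have hΨm : ∀ q, Measurable (Ψ q) := by
    intro q
    refine Measurable.mul ?_ (by fun_prop)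
    by_cases hq : q = (i, k)
    · simp only [hq, if_true]; exact Measurable.ite hT measurable_const measurable_const
    · simp only [hq, if_false]; exact measurable_const
  have e : ∀ β : Knot N → ℝ, (if β k ∈ T then (1 : ℝ) else 0) *
      Real.exp (partLoglik n N z xd Y S β) = outerFactor xd Y * ∏ q ∈ blocks S, Ψ q (β q.2) := by
    intro β
    rw [exp_partLoglik hz h0 h1 hS]
    simp only [hΨ, Finset.prod_mul_distrib]
    rw [Finset.prod_ite_eq' (blocks S) (i, k) (fun q => if β q.2 ∈ T then (1 : ℝ) else 0),
      if_pos hmem]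
    ring
  unfold massOn
  simp only [e]
  rw [integral_const_mul, integral_blocks_partCondPrior hz h0 h1 hS hg Ψ hΨm,
    ← Finset.mul_prod_erase _ _ hmem]
  have e2 : ∏ q ∈ (blocks S).erase (i, k), ∫ b, g q.2 b * Ψ q b
      = ∏ q ∈ (blocks S).erase (i, k), marg (g q.2) Y (pts xd z q) := by
    refine Finset.prod_congr rfl fun q hq => ?_
    simp only [hΨ, if_neg (Finset.ne_of_mem_erase hq), one_mul, marg]
  rw [e2]
  simp only [partWeight, if_pos hS, blockMass, Finset.prod_mul_distrib]
  change (∏ q ∈ blocks S, _) * _ = _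
  rw [← Finset.mul_prod_erase _ _ hmem]
  simp only [hΨ, if_true]
  ring

end Factorisation

section PosteriorBounds

variable {n N : ℕ} {z : Knot N → ℝ} {S : Finset (Knot N)} {xd : Fin n → ℝ}
  {g : Knot N → ℝ → ℝ} {c₀ c₁ B₀ B : ℝ} {Y : Fin n → ℝ}

lemma partWeight_nonneg (hz : StrictMono z) (B : ℝ) (S : Finset (Knot N)) :
    0 ≤ partWeight N z B S := by
  unfold partWeight
  split_ifs
  · refine Finset.prod_nonneg fun q hq => Real.rpow_nonneg ?_ _
    have := (Finset.mem_filter.1 hq).2.2.2.1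
    linarith [hz this]
  · exact le_rfl

lemma mass_nonneg (hz : StrictMono z) (S : Finset (Knot N)) : 0 ≤ mass xd z B g Y S :=
  mul_nonneg (partWeight_nonneg hz B S) (integral_nonneg fun _ => (Real.exp_pos _).le)

lemma massOn_nonneg (hz : StrictMono z) (k : Knot N) (T : Set ℝ) (S : Finset (Knot N)) :
    0 ≤ massOn xd z B g Y k T S := by
  refine mul_nonneg (partWeight_nonneg hz B S) (integral_nonneg fun _ => ?_)
  simp only [Pi.zero_apply]
  split_ifs <;> positivity

lemma measurable_fPart (S : Finset (Knot N)) (x : ℝ) :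
    Measurable fun β : Knot N → ℝ => fPart N z S β x := by
  unfold fPart
  refine Finset.measurable_fun_sum _ fun j _ => Finset.measurable_fun_sum _ fun i _ => ?_
  split_ifs <;> fun_prop

lemma integrable_exp_partLoglik (hg : ∀ j, IsGoodDensity c₀ c₁ B₀ (g j)) (S : Finset (Knot N)) :
    Integrable (fun β => Real.exp (partLoglik n N z xd Y S β)) (partCondPrior N g S) := by
  have := isFiniteMeasure_partCondPrior hg S
  refine Integrable.of_bound (C := 1) ?_ (ae_of_all _ fun β => ?_)
  · have := fun x => measurable_fPart (z := z) S x
    unfold partLoglik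
    exact Measurable.aestronglyMeasurable (by fun_prop)
  · rw [Real.norm_of_nonneg (Real.exp_pos _).le, Real.exp_le_one_iff, partLoglik]
    have : 0 ≤ ∑ i, (Y i - fPart N z S β (xd i)) ^ 2 := Finset.sum_nonneg fun _ _ => sq_nonneg _
    linarith

lemma integrable_ite_mul_exp (hg : ∀ j, IsGoodDensity c₀ c₁ B₀ (g j)) (S : Finset (Knot N))
    (k : Knot N) {T : Set ℝ} (hT : MeasurableSet T) :
    Integrable (fun β : Knot N → ℝ => (if β k ∈ T then (1 : ℝ) else 0) *
      Real.exp (partLoglik n N z xd Y S β)) (partCondPrior N g S) := by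
  refine (integrable_exp_partLoglik hg S).bdd_mul (c := 1) ?_ (ae_of_all _ fun β => ?_)
  · have : MeasurableSet {β : Knot N → ℝ | β k ∈ T} := measurable_pi_apply k hT
    exact (Measurable.ite this measurable_const measurable_const).aestronglyMeasurable
  · split_ifs <;> simp

lemma massOn_le_mass (hz : StrictMono z) (hg : ∀ j, IsGoodDensity c₀ c₁ B₀ (g j)) (k : Knot N)
    {T : Set ℝ} (hT : MeasurableSet T) (S : Finset (Knot N)) :
    massOn xd z B g Y k T S ≤ mass xd z B g Y S := by
  refine mul_le_mul_of_nonneg_left ?_ (partWeight_nonneg hz B S)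
  refine integral_mono (integrable_ite_mul_exp hg S k hT) (integrable_exp_partLoglik hg S)
    fun β => ?_
  have := Real.exp_pos (partLoglik n N z xd Y S β)
  simp only
  split_ifs <;> linarith

/-- The posterior probability that `(z_i, z_j]` and `(z_j, z_k]` are blocks. -/
def postPair (xd : Fin n → ℝ) (z : Knot N → ℝ) (B : ℝ) (g : Knot N → ℝ → ℝ) (Y : Fin n → ℝ)
    (t : Knot N × Knot N × Knot N) : ℝ :=
  (∑ S ∈ Finset.univ.filter fun S => IsPart N S ∧ Consec N S t.1 t.2.1 ∧ Consec N S t.2.1 t.2.2,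
    mass xd z B g Y S) / ∑ S : Finset (Knot N), mass xd z B g Y S

/-- The posterior probability that `(z_i, z_k]` is a block with coefficient in `T`. -/
def postCoef (xd : Fin n → ℝ) (z : Knot N → ℝ) (B : ℝ) (g : Knot N → ℝ → ℝ) (Y : Fin n → ℝ)
    (i k : Knot N) (T : Set ℝ) : ℝ :=
  (∑ S ∈ Finset.univ.filter fun S => IsPart N S ∧ Consec N S i k,
    massOn xd z B g Y k T S) / ∑ S : Finset (Knot N), mass xd z B g Y S

lemma sum_mass_nonneg (hz : StrictMono z) (F : Finset (Finset (Knot N))) :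
    0 ≤ ∑ S ∈ F, mass xd z B g Y S :=
  Finset.sum_nonneg fun _ _ => mass_nonneg hz _

lemma postPair_nonneg (hz : StrictMono z) (t : Knot N × Knot N × Knot N) :
    0 ≤ postPair xd z B g Y t :=
  div_nonneg (sum_mass_nonneg hz _) (sum_mass_nonneg hz _)

lemma postCoef_nonneg (hz : StrictMono z) (i k : Knot N) (T : Set ℝ) :
    0 ≤ postCoef xd z B g Y i k T :=
  div_nonneg (Finset.sum_nonneg fun _ _ => massOn_nonneg hz _ _ _) (sum_mass_nonneg hz _)

lemma postPair_le_one (hz : StrictMono z) (t : Knot N × Knot N × Knot N) :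
    postPair xd z B g Y t ≤ 1 :=
  div_le_one_of_le₀ (Finset.sum_le_univ_sum_of_nonneg fun _ => mass_nonneg hz _)
    (sum_mass_nonneg hz _)

lemma postCoef_le_one (hz : StrictMono z) (hg : ∀ j, IsGoodDensity c₀ c₁ B₀ (g j)) (i k : Knot N)
    {T : Set ℝ} (hT : MeasurableSet T) : postCoef xd z B g Y i k T ≤ 1 :=
  div_le_one_of_le₀ ((Finset.sum_le_sum fun S _ => massOn_le_mass hz hg k hT S).trans
    (Finset.sum_le_univ_sum_of_nonneg fun _ => mass_nonneg hz _)) (sum_mass_nonneg hz _)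

lemma sum_comp_le_of_injOn {α : Type*} [Fintype α] {F : Finset α} {G : α → α}
    (hG : Set.InjOn G F) {w : α → ℝ} (hw : ∀ a, 0 ≤ w a) :
    ∑ a ∈ F, w (G a) ≤ ∑ a, w a := by
  rw [← Finset.sum_image (f := w) hG]
  exact Finset.sum_le_univ_sum_of_nonneg hw

lemma sum_div_le_of_injOn {α : Type*} [Fintype α] {F : Finset α} {G : α → α}
    (hG : Set.InjOn G F) {w v : α → ℝ} (hw : ∀ a, 0 ≤ w a) {r : ℝ} (hr : 0 ≤ r)
    (h : ∀ a ∈ F, v a ≤ r * w (G a)) :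
    (∑ a ∈ F, v a) / ∑ a, w a ≤ r := by
  refine div_le_of_le_mul₀ (Finset.sum_nonneg fun a _ => hw a) hr ?_
  calc _ ≤ ∑ a ∈ F, r * w (G a) := Finset.sum_le_sum h
    _ = r * ∑ a ∈ F, w (G a) := by rw [Finset.mul_sum]
    _ ≤ _ := mul_le_mul_of_nonneg_left (sum_comp_le_of_injOn hG hw) hr

lemma outerFactor_pos : 0 < outerFactor xd Y := Real.exp_pos _

lemma blockMass_nonneg (hz : StrictMono z) (hg : ∀ j, IsGoodDensity c₀ c₁ B₀ (g j))
    {q : Knot N × Knot N} (hq : q.1 < q.2) : 0 ≤ blockMass xd z B g Y q := by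
  refine mul_nonneg (Real.rpow_nonneg (by linarith [hz hq]) _) (integral_nonneg fun b => ?_)
  exact mul_nonneg ((hg _).nonneg b) (Real.exp_pos _).le

lemma prod_erase_blockMass_nonneg (hz : StrictMono z) (hg : ∀ j, IsGoodDensity c₀ c₁ B₀ (g j))
    (q₀ : Knot N × Knot N) : 0 ≤ ∏ q ∈ (blocks S).erase q₀, blockMass xd z B g Y q :=
  Finset.prod_nonneg fun _ hq =>
    blockMass_nonneg hz hg (mem_blocks.1 (Finset.mem_of_mem_erase hq)).2.2.1

lemma postPair_le (hz : StrictMono z) (h0 : z 0 = 0) (h1 : z (Fin.last N) = 1)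
    (hg : ∀ j, IsGoodDensity c₀ c₁ B₀ (g j)) {i j k : Knot N} {r : ℝ} (hr : 0 ≤ r)
    (h : blockMass xd z B g Y (i, j) * blockMass xd z B g Y (j, k) ≤
      r * blockMass xd z B g Y (i, k)) :
    postPair xd z B g Y (i, j, k) ≤ r := by
  refine sum_div_le_of_injOn (G := fun S => S.erase j) ?_ (mass_nonneg hz) hr ?_
  · intro S hS S' hS' he
    have hj : j ∈ S := (Finset.mem_filter.1 (Finset.mem_coe.1 hS)).2.2.1.2.1
    have hj' : j ∈ S' := (Finset.mem_filter.1 (Finset.mem_coe.1 hS')).2.2.1.2.1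
    rw [← Finset.insert_erase hj, ← Finset.insert_erase hj']
    simp only at he
    rw [he]
  · intro S hS
    obtain ⟨hP, hij, hjk⟩ := (Finset.mem_filter.1 hS).2
    simp only at hij hjk
    have hP' : IsPart N (S.erase j) :=
      ⟨Finset.mem_erase.2 ⟨((Fin.zero_le _).trans_lt hij.2.2.1).ne, hP.1⟩,
        Finset.mem_erase.2 ⟨(hjk.2.2.1.trans_le (Fin.le_last _)).ne', hP.2⟩⟩
    have hik := consec_erase hij hjk
    rw [mass_eq hz h0 h1 hP hg, mass_eq hz h0 h1 hP' hg, ← Finset.mul_prod_erase (blocks (S.erase j)) _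
      (mem_blocks (q := (i, k)).2 hik)]
    conv_lhs => rw [← Finset.insert_erase hij.2.1, prod_blocks_insert hik hij.2.2.1 hjk.2.2.1]
    have hp := prod_erase_blockMass_nonneg (S := S.erase j) (xd := xd) (B := B) (Y := Y) hz hg (i, k)
    have := mul_le_mul_of_nonneg_left (mul_le_mul_of_nonneg_right h hp)
      (outerFactor_pos (xd := xd) (Y := Y)).le
    linarith

lemma postCoef_le (hz : StrictMono z) (h0 : z 0 = 0) (h1 : z (Fin.last N) = 1)
    (hg : ∀ j, IsGoodDensity c₀ c₁ B₀ (g j)) {i a b k : Knot N} (hia : i ≤ a) (hab : a < b)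
    (hbk : b ≤ k) {T : Set ℝ} (hT : MeasurableSet T) {r : ℝ} (hr : 0 ≤ r)
    (h : (z k - z i) ^ B * ∫ b, g k b * ((if b ∈ T then (1 : ℝ) else 0) *
        Real.exp (-(1 / 2) * ssq Y (pts xd z (i, k)) b)) ≤
      r * (extOne (blockMass xd z B g Y) i a * blockMass xd z B g Y (a, b) *
        extOne (blockMass xd z B g Y) b k)) :
    postCoef xd z B g Y i k T ≤ r := by
  refine sum_div_le_of_injOn (G := fun S => insert b (insert a S)) ?_ (mass_nonneg hz) hr ?_
  · have key : ∀ S : Finset (Knot N), Consec N S i k → ∀ m, m ∈ S ↔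
        m ∈ insert b (insert a S) ∧ (m ≤ i ∨ k ≤ m) := by
      intro S hS m
      simp only [Finset.mem_insert]
      constructor
      · intro hm
        refine ⟨Or.inr (Or.inr hm), ?_⟩
        by_contra hcon
        rw [not_or, not_le, not_le] at hcon
        exact hS.2.2.2 m hm hcon
      · rintro ⟨rfl | rfl | hm, hmk⟩
        · rcases hmk with hmk | hmk
          · exact absurd (hia.trans_lt hab) (not_lt.2 hmk)
          · rw [le_antisymm hbk hmk]; exact hS.2.1
        · rcases hmk with hmk | hmk
          · rw [le_antisymm hmk hia]; exact hS.1
          · exact absurd (hab.trans_le hbk) (not_lt.2 hmk)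
        · exact hm
    intro S hS S' hS' he
    have hc := (Finset.mem_filter.1 (Finset.mem_coe.1 hS)).2.2
    have hc' := (Finset.mem_filter.1 (Finset.mem_coe.1 hS')).2.2
    simp only at he
    ext m
    rw [key S hc m, key S' hc' m, he]
  · intro S hS
    obtain ⟨hP, hik⟩ := (Finset.mem_filter.1 hS).2
    have hP' : IsPart N (insert b (insert a S)) :=
      ⟨Finset.mem_insert_of_mem (Finset.mem_insert_of_mem hP.1),
        Finset.mem_insert_of_mem (Finset.mem_insert_of_mem hP.2)⟩
    rw [massOn_eq hz h0 h1 hP hg B Y hik hT, mass_eq hz h0 h1 hP' hg,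
      prod_blocks_insert_insert hik hia hab hbk]
    have hp := prod_erase_blockMass_nonneg (S := S) (xd := xd) (B := B) (Y := Y) hz hg (i, k)
    have := mul_le_mul_of_nonneg_left (mul_le_mul_of_nonneg_right h hp)
      (outerFactor_pos (xd := xd) (Y := Y)).le
    linarith

lemma le_rpow_of_le_of_le_one {p r θ : ℝ} (hp : 0 ≤ p) (hp1 : p ≤ 1) (hpr : p ≤ r) (hθ : 0 < θ)
    (hθ1 : θ ≤ 1) : p ≤ r ^ θ := by
  refine le_trans ?_ (Real.rpow_le_rpow hp hpr hθ.le)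
  rcases hp.eq_or_lt with rfl | hp0
  · exact Real.rpow_nonneg le_rfl _
  · simpa using Real.rpow_le_rpow_of_exponent_ge hp0 hp1 hθ1

lemma partPost_nonneg (hz : StrictMono z) (A : Finset (Knot N) → (Knot N → ℝ) → Prop) :
    0 ≤ partPost n N z xd B g Y A := by
  refine div_nonneg (Finset.sum_nonneg fun S _ => mul_nonneg (partWeight_nonneg hz B S)
    (integral_nonneg fun β => ?_)) (sum_mass_nonneg hz _)
  simp only [Pi.zero_apply]
  split_ifs <;> positivity

lemma partPost_le (hz : StrictMono z) (hg : ∀ j, IsGoodDensity c₀ c₁ B₀ (g j))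
    {A : Finset (Knot N) → (Knot N → ℝ) → Prop}
    {P : Finset (Knot N × Knot N × Knot N)} {Q : Finset (Knot N × Knot N × Knot N × Knot N)}
    {T : Knot N × Knot N × Knot N × Knot N → Set ℝ} (hT : ∀ u, MeasurableSet (T u))
    (hA : ∀ S β, IsPart N S → A S β →
      (∃ t ∈ P, Consec N S t.1 t.2.1 ∧ Consec N S t.2.1 t.2.2) ∨
      ∃ u ∈ Q, Consec N S u.1 u.2.2.2 ∧ β u.2.2.2 ∈ T u) :
    partPost n N z xd B g Y A ≤ ∑ t ∈ P, postPair xd z B g Y t +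
      ∑ u ∈ Q, postCoef xd z B g Y u.1 u.2.2.2 (T u) := by
  unfold postPair postCoef partPost
  rw [← Finset.sum_div, ← Finset.sum_div, ← add_div]
  refine div_le_div_of_nonneg_right ?_ (sum_mass_nonneg hz _)
  simp only [Finset.sum_filter]
  rw [Finset.sum_comm (s := P), Finset.sum_comm (s := Q), ← Finset.sum_add_distrib]
  refine Finset.sum_le_sum fun S _ => ?_
  by_cases hS : IsPart N S
  swap
  · have e : partWeight N z B S = 0 := if_neg hS
    rw [e, zero_mul]
    refine add_nonneg (Finset.sum_nonneg fun t _ => ?_) (Finset.sum_nonneg fun t _ => ?_)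
    · split_ifs
      exacts [mass_nonneg hz _, le_rfl]
    · split_ifs
      exacts [massOn_nonneg hz _ _ _, le_rfl]
  have e1 : ∀ t : Knot N × Knot N × Knot N,
      (if IsPart N S ∧ Consec N S t.1 t.2.1 ∧ Consec N S t.2.1 t.2.2 then mass xd z B g Y S else 0)
      = partWeight N z B S * ∫ β, (if Consec N S t.1 t.2.1 ∧ Consec N S t.2.1 t.2.2 then
        Real.exp (partLoglik n N z xd Y S β) else 0) ∂partCondPrior N g S := by
    intro t
    simp only [hS, true_and]
    split_ifs <;> simp [mass]
  have e2 : ∀ u : Knot N × Knot N × Knot N × Knot N,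
      (if IsPart N S ∧ Consec N S u.1 u.2.2.2 then massOn xd z B g Y u.2.2.2 (T u) S else 0)
      = partWeight N z B S * ∫ β, (if Consec N S u.1 u.2.2.2 then
        (if β u.2.2.2 ∈ T u then (1 : ℝ) else 0) * Real.exp (partLoglik n N z xd Y S β) else 0)
          ∂partCondPrior N g S := by
    intro u
    simp only [hS, true_and]
    split_ifs <;> simp [massOn]
  have i1 : ∀ t ∈ P, Integrable (fun β => if Consec N S t.1 t.2.1 ∧ Consec N S t.2.1 t.2.2 then
      Real.exp (partLoglik n N z xd Y S β) else 0) (partCondPrior N g S) := by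
    intro t _
    split_ifs
    exacts [integrable_exp_partLoglik hg S, integrable_zero _ _ _]
  have i2 : ∀ u ∈ Q, Integrable (fun β => if Consec N S u.1 u.2.2.2 then
      (if β u.2.2.2 ∈ T u then (1 : ℝ) else 0) * Real.exp (partLoglik n N z xd Y S β) else 0)
      (partCondPrior N g S) := by
    intro u _
    split_ifs
    exacts [integrable_ite_mul_exp hg S _ (hT u), integrable_zero _ _ _]
  simp only [e1, e2]
  rw [← Finset.mul_sum, ← Finset.mul_sum, ← mul_add, ← integral_finsetSum _ i1,
    ← integral_finsetSum _ i2, ← integral_add (integrable_finsetSum _ i1)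
      (integrable_finsetSum _ i2)]
  refine mul_le_mul_of_nonneg_left ?_ (partWeight_nonneg hz B S)
  refine integral_mono_of_nonneg (ae_of_all _ fun β => ?_)
    ((integrable_finsetSum _ i1).add (integrable_finsetSum _ i2)) (ae_of_all _ fun β => ?_)
  · simp only [Pi.zero_apply]
    split_ifs <;> positivity
  · have hexp := Real.exp_pos (partLoglik n N z xd Y S β)
    have n1 : ∀ t ∈ P, 0 ≤ (if Consec N S t.1 t.2.1 ∧ Consec N S t.2.1 t.2.2 then
        Real.exp (partLoglik n N z xd Y S β) else 0) := by
      intro t _; split_ifs <;> positivity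
    have n2 : ∀ u ∈ Q, 0 ≤ (if Consec N S u.1 u.2.2.2 then
        (if β u.2.2.2 ∈ T u then (1 : ℝ) else 0) * Real.exp (partLoglik n N z xd Y S β) else 0) := by
      intro u _; split_ifs <;> positivity
    simp only
    by_cases hAS : A S β
    swap
    · rw [if_neg hAS, zero_mul]
      exact add_nonneg (Finset.sum_nonneg n1) (Finset.sum_nonneg n2)
    rw [if_pos hAS, one_mul]
    rcases hA S β hS hAS with ⟨t, ht, hc⟩ | ⟨u, hu, hc⟩
    · have := Finset.single_le_sum n1 ht
      rw [if_pos hc] at this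
      linarith [Finset.sum_nonneg n2]
    · have := Finset.single_le_sum n2 hu
      rw [if_pos hc.1, if_pos hc.2, one_mul] at this
      linarith [Finset.sum_nonneg n1]

end PosteriorBounds

section BlockRatios

variable {n N : ℕ} {z : Knot N → ℝ} {xd : Fin n → ℝ} {g : Knot N → ℝ → ℝ} {c₀ c₁ B₀ B : ℝ}

lemma pts_union (hz : StrictMono z) {i j k : Knot N} (hij : i ≤ j) (hjk : j ≤ k) :
    pts xd z (i, k) = pts xd z (i, j) ∪ pts xd z (j, k) := by
  ext a
  simp only [Finset.mem_union, mem_pts]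
  rw [← Set.mem_union, Ioc_union_Ioc_eq_Ioc (hz.monotone hij) (hz.monotone hjk)]

lemma pts_disjoint (z : Knot N → ℝ) (xd : Fin n → ℝ) (i j k : Knot N) :
    Disjoint (pts xd z (i, j)) (pts xd z (j, k)) := by
  rw [Finset.disjoint_left]
  intro a ha hb
  rw [mem_pts] at ha hb
  exact absurd hb.1 (not_lt.mpr ha.2)

lemma ssq_pts_add (hz : StrictMono z) {i j k : Knot N} (hij : i ≤ j) (hjk : j ≤ k)
    (Y : Fin n → ℝ) (b : ℝ) :
    ssq Y (pts xd z (i, k)) b = ssq Y (pts xd z (i, j)) b + ssq Y (pts xd z (j, k)) b := by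
  rw [pts_union hz hij hjk]
  exact Finset.sum_union (pts_disjoint z xd i j k)

lemma card_pts_add (hz : StrictMono z) {i j k : Knot N} (hij : i ≤ j) (hjk : j ≤ k) :
    (pts xd z (i, k)).card = (pts xd z (i, j)).card + (pts xd z (j, k)).card := by
  rw [pts_union hz hij hjk]
  exact Finset.card_union_of_disjoint (pts_disjoint z xd i j k)

lemma inv_sqrt_le_of_le_two_mul {a b : ℝ} (ha : 0 < a) (h : b ≤ 2 * a) (hb : 0 < b) :
    (√a)⁻¹ ≤ √2 * (√b)⁻¹ := by
  have h1 : √b ≤ √2 * √a := by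
    rw [← Real.sqrt_mul (by norm_num)]
    exact Real.sqrt_le_sqrt h
  have := Real.sqrt_pos.mpr ha
  have := Real.sqrt_pos.mpr hb
  rw [← div_eq_mul_inv, inv_eq_one_div, div_le_div_iff₀ ‹_› ‹_›]
  linarith

/-- The loss in merging two adjacent blocks with (almost) the same signal average. -/
def mergeLoss (f : Fin n → ℝ) (xd : Fin n → ℝ) (z : Knot N → ℝ) (i j k : Knot N) (v : ℝ) : ℝ :=
  (pts xd z (i, j)).card * (v - avg f (pts xd z (i, j))) ^ 2 +
    (pts xd z (j, k)).card * (v - avg f (pts xd z (j, k))) ^ 2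

lemma marg_mul_marg_le (hz : StrictMono z) (hg : ∀ j, IsGoodDensity c₀ c₁ B₀ (g j))
    (hc₁ : 0 ≤ c₁) {i j k : Knot N} (hij : i < j) (hjk : j < k) (f ε : Fin n → ℝ) :
    marg (g j) (fun a => f a + ε a) (pts xd z (i, j)) *
        marg (g k) (fun a => f a + ε a) (pts xd z (j, k)) ≤
      (1 + c₁ * √(4 * Real.pi)) * (√2 * (√((pts xd z (i, k)).card + 1))⁻¹) *
      (Real.exp (-(1 / 2) * (ssq (fun a => f a + ε a) (pts xd z (i, j)) (avg f (pts xd z (i, j))) -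
        noiseSq (pts xd z (i, j)) ε)) *
      Real.exp (-(1 / 2) * (ssq (fun a => f a + ε a) (pts xd z (j, k)) (avg f (pts xd z (j, k))) -
        noiseSq (pts xd z (j, k)) ε))) := by
  have hI := marg_le (hg j) f ε (pts xd z (i, j))
  have hJ := marg_le (hg k) f ε (pts xd z (j, k))
  have hI' := marg_le_sqrt (hg j) hc₁ f ε (pts xd z (i, j))
  have hJ' := marg_le_sqrt (hg k) hc₁ f ε (pts xd z (j, k))
  have hI0 : 0 ≤ marg (g j) (fun a => f a + ε a) (pts xd z (i, j)) :=
    integral_nonneg fun b => mul_nonneg ((hg j).nonneg b) (Real.exp_pos _).le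
  have hJ0 : 0 ≤ marg (g k) (fun a => f a + ε a) (pts xd z (j, k)) :=
    integral_nonneg fun b => mul_nonneg ((hg k).nonneg b) (Real.exp_pos _).le
  have hcard : ((pts xd z (i, k)).card : ℝ) = (pts xd z (i, j)).card + (pts xd z (j, k)).card := by
    exact_mod_cast card_pts_add hz hij.le hjk.le
  set EI := Real.exp (-(1 / 2) * (ssq (fun a => f a + ε a) (pts xd z (i, j))
    (avg f (pts xd z (i, j))) - noiseSq (pts xd z (i, j)) ε)) with hEI
  set EJ := Real.exp (-(1 / 2) * (ssq (fun a => f a + ε a) (pts xd z (j, k))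
    (avg f (pts xd z (j, k))) - noiseSq (pts xd z (j, k)) ε)) with hEJ
  have hEI0 : 0 < EI := Real.exp_pos _
  have hEJ0 : 0 < EJ := Real.exp_pos _
  have hC : 0 ≤ 1 + c₁ * √(4 * Real.pi) := by positivity
  set C := 1 + c₁ * √(4 * Real.pi)
  have h1 : (0 : ℝ) ≤ (pts xd z (i, j)).card := by positivity
  have h2 : (0 : ℝ) ≤ (pts xd z (j, k)).card := by positivity
  rcases le_total ((pts xd z (i, j)).card : ℝ) (pts xd z (j, k)).card with hle | hle
  · calc _ ≤ EI * (C * (√((pts xd z (j, k)).card + 1))⁻¹ * EJ) := by gcongr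
      _ = C * (√((pts xd z (j, k)).card + 1))⁻¹ * (EI * EJ) := by ring
      _ ≤ _ := by
        gcongr
        exact inv_sqrt_le_of_le_two_mul (by linarith) (by linarith) (by linarith)
  · calc _ ≤ (C * (√((pts xd z (i, j)).card + 1))⁻¹ * EI) * EJ := by gcongr
      _ = C * (√((pts xd z (i, j)).card + 1))⁻¹ * (EI * EJ) := by ring
      _ ≤ _ := by
        gcongr
        exact inv_sqrt_le_of_le_two_mul (by linarith) (by linarith) (by linarith)

/-- The constant in front of the loss of merging two blocks. -/
def mergeConst (c₀ c₁ ρ : ℝ) : ℝ :=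
  (1 + c₁ * √(4 * Real.pi)) * √2 / (c₀ * ρ * Real.exp (-(1 / 2)))

lemma mergeConst_pos (hc₀ : 0 < c₀) (hc₁ : 0 ≤ c₁) {ρ : ℝ} (hρ : 0 < ρ) :
    0 < mergeConst c₀ c₁ ρ := by
  unfold mergeConst
  positivity

lemma blockMass_mul_le (hz : StrictMono z) (hg : ∀ j, IsGoodDensity c₀ c₁ B₀ (g j))
    (hc₀ : 0 < c₀) (hc₁ : 0 ≤ c₁) (hB : 0 ≤ B) {i j k : Knot N} (hij : i < j) (hjk : j < k)
    (f ε : Fin n → ℝ) {v ρ τ : ℝ} (hρ : 0 < ρ) (hρ1 : ρ ≤ 1) (hv : |v| + ρ ≤ B₀) (hτ : 0 < τ) :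
    blockMass xd z B g (fun a => f a + ε a) (i, j) *
        blockMass xd z B g (fun a => f a + ε a) (j, k) ≤
      (min (z j - z i) (z k - z j) ^ B * mergeConst c₀ c₁ ρ *
        Real.exp (1 / 2 * (1 + τ) * (noiseSq (pts xd z (i, j)) ε + noiseSq (pts xd z (j, k)) ε) +
          1 / 2 * (1 + τ⁻¹) * mergeLoss f xd z i j k v)) *
      blockMass xd z B g (fun a => f a + ε a) (i, k) := by
  have hzi := hz hij
  have hzj := hz hjk
  set Y : Fin n → ℝ := fun a => f a + ε a with hY
  have hpow : (z j - z i) ^ B * (z k - z j) ^ B ≤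
      min (z j - z i) (z k - z j) ^ B * (z k - z i) ^ B := by
    have hm : 0 ≤ min (z j - z i) (z k - z j) := le_min (by linarith) (by linarith)
    rw [← Real.mul_rpow (by linarith) (by linarith), ← Real.mul_rpow hm (by linarith)]
    refine Real.rpow_le_rpow (mul_nonneg (by linarith) (by linarith)) ?_ hB
    rcases le_total (z j - z i) (z k - z j) with h | h
    · rw [min_eq_left h]; gcongr
    · rw [min_eq_right h, mul_comm]; gcongr
  have hM := marg_mul_marg_le (xd := xd) hz hg hc₁ hij hjk f ε
  have hL := marg_lower (hg k) Y (pts xd z (i, k)) hρ hρ1 hv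
  have hsplit := ssq_pts_add (xd := xd) hz hij.le hjk.le Y v
  have h1 := ssq_le_avg f ε (pts xd z (i, j)) v hτ
  have h2 := ssq_le_avg f ε (pts xd z (j, k)) v hτ
  set ZI := noiseSq (pts xd z (i, j)) ε
  set ZJ := noiseSq (pts xd z (j, k)) ε
  set qI := ssq Y (pts xd z (i, j)) (avg f (pts xd z (i, j)))
  set qJ := ssq Y (pts xd z (j, k)) (avg f (pts xd z (j, k)))
  set X := 1 / 2 * (1 + τ) * (ZI + ZJ) + 1 / 2 * (1 + τ⁻¹) * mergeLoss f xd z i j k v with hX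
  have hexp : Real.exp (-(1 / 2) * (qI - ZI)) * Real.exp (-(1 / 2) * (qJ - ZJ)) ≤
      Real.exp X * Real.exp (-(1 / 2) * ssq Y (pts xd z (i, k)) v) := by
    rw [← Real.exp_add, ← Real.exp_add, Real.exp_le_exp, hsplit, hX, mergeLoss]
    linarith
  set s := (√((pts xd z (i, k)).card + 1))⁻¹ with hs
  have hs0 : 0 ≤ s := by positivity
  set E := Real.exp (-(1 / 2) * ssq Y (pts xd z (i, k)) v) with hE
  have hcpos : 0 < c₀ * ρ * Real.exp (-(1 / 2)) := by positivity
  have hmm : marg (g j) Y (pts xd z (i, j)) * marg (g k) Y (pts xd z (j, k)) ≤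
      mergeConst c₀ c₁ ρ * Real.exp X * marg (g k) Y (pts xd z (i, k)) := by
    calc _ ≤ (1 + c₁ * √(4 * Real.pi)) * (√2 * s) * (Real.exp X * E) :=
          hM.trans (mul_le_mul_of_nonneg_left hexp (by positivity))
      _ = mergeConst c₀ c₁ ρ * Real.exp X * (c₀ * ρ * Real.exp (-(1 / 2)) * s * E) := by
          unfold mergeConst
          field_simp
      _ ≤ _ := mul_le_mul_of_nonneg_left hL
          (mul_nonneg (mergeConst_pos hc₀ hc₁ hρ).le (Real.exp_pos _).le)
  have hI0 : 0 ≤ marg (g j) Y (pts xd z (i, j)) * marg (g k) Y (pts xd z (j, k)) :=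
    mul_nonneg (integral_nonneg fun b => mul_nonneg ((hg j).nonneg b) (Real.exp_pos _).le)
      (integral_nonneg fun b => mul_nonneg ((hg k).nonneg b) (Real.exp_pos _).le)
  have hm : 0 ≤ min (z j - z i) (z k - z j) := le_min (by linarith) (by linarith)
  unfold blockMass
  calc _ = ((z j - z i) ^ B * (z k - z j) ^ B) *
        (marg (g j) Y (pts xd z (i, j)) * marg (g k) Y (pts xd z (j, k))) := by ring
    _ ≤ (min (z j - z i) (z k - z j) ^ B * (z k - z i) ^ B) *
        (mergeConst c₀ c₁ ρ * Real.exp X * marg (g k) Y (pts xd z (i, k))) :=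
      mul_le_mul hpow hmm hI0 (mul_nonneg (Real.rpow_nonneg hm _)
        (Real.rpow_nonneg (by linarith) _))
    _ = _ := by ring

/-- The pointwise bound on the posterior mass of a pair of adjacent blocks. -/
def pairBound (θ τ R m : ℝ) (xd : Fin n → ℝ) (z : Knot N → ℝ) (t : Knot N × Knot N × Knot N)
    (ε : Fin n → ℝ) : ℝ :=
  R ^ θ * Real.exp (θ * (1 / 2 * (1 + τ⁻¹) * m)) * Real.exp (θ * (1 + τ) / 2 *
    (noiseSq (pts xd z (t.1, t.2.1)) ε + noiseSq (pts xd z (t.2.1, t.2.2)) ε))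

lemma postPair_le_pairBound (hz : StrictMono z) (h0 : z 0 = 0) (h1 : z (Fin.last N) = 1)
    (hg : ∀ j, IsGoodDensity c₀ c₁ B₀ (g j))
    (hc₀ : 0 < c₀) (hc₁ : 0 ≤ c₁) (hB : 0 ≤ B) {i j k : Knot N} (hij : i < j) (hjk : j < k)
    (f ε : Fin n → ℝ) {v ρ τ θ d m : ℝ} (hρ : 0 < ρ) (hρ1 : ρ ≤ 1) (hv : |v| + ρ ≤ B₀)
    (hτ : 0 < τ) (hθ : 0 < θ) (hθ1 : θ ≤ 1) (hd : min (z j - z i) (z k - z j) ≤ d)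
    (hm : mergeLoss f xd z i j k v ≤ m) :
    postPair xd z B g (fun a => f a + ε a) (i, j, k) ≤
      pairBound θ τ (d ^ B * mergeConst c₀ c₁ ρ) m xd z (i, j, k) ε := by
  have hzi := hz hij
  have hzj := hz hjk
  have hm0 : 0 ≤ min (z j - z i) (z k - z j) := le_min (by linarith) (by linarith)
  have hC := mergeConst_pos hc₀ hc₁ hρ
  have hbd := blockMass_mul_le (xd := xd) hz hg hc₀ hc₁ hB hij hjk f ε hρ hρ1 hv hτ
  set r := min (z j - z i) (z k - z j) ^ B * mergeConst c₀ c₁ ρ *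
        Real.exp (1 / 2 * (1 + τ) * (noiseSq (pts xd z (i, j)) ε + noiseSq (pts xd z (j, k)) ε) +
          1 / 2 * (1 + τ⁻¹) * mergeLoss f xd z i j k v) with hr
  have hr0 : 0 ≤ r := by
    have := Real.rpow_nonneg hm0 B
    positivity
  refine (le_rpow_of_le_of_le_one (postPair_nonneg hz _) (postPair_le_one hz _)
    (postPair_le hz h0 h1 hg hr0 hbd) hθ hθ1).trans ?_
  have hrle : r ≤ (d ^ B * mergeConst c₀ c₁ ρ) *
      Real.exp (1 / 2 * (1 + τ) * (noiseSq (pts xd z (i, j)) ε + noiseSq (pts xd z (j, k)) ε) +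
          1 / 2 * (1 + τ⁻¹) * m) := by
    have := Real.rpow_nonneg (hm0.trans hd) B
    rw [hr]
    gcongr
  refine (Real.rpow_le_rpow hr0 hrle hθ.le).trans (le_of_eq ?_)
  rw [Real.mul_rpow (mul_nonneg (Real.rpow_nonneg (hm0.trans hd) _) hC.le) (Real.exp_pos _).le,
    ← Real.exp_mul, pairBound, mul_assoc _ (Real.exp _) (Real.exp _), ← Real.exp_add]
  congr 2
  dsimp only
  ring

lemma integral_pairBound {θ τ : ℝ} (hθ : 0 ≤ θ) (hτ : 0 ≤ τ) (hθτ : θ * (1 + τ) < 1) {R : ℝ}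
    (hR : 0 ≤ R) (m : ℝ) (t : Knot N × Knot N × Knot N) :
    Integrable (pairBound θ τ R m xd z t) (regNoise n) ∧
    ∫ ε, pairBound θ τ R m xd z t ε ∂regNoise n ≤
      R ^ θ * Real.exp (θ * (1 / 2 * (1 + τ⁻¹) * m)) * (1 - θ * (1 + τ))⁻¹ ^ 2 := by
  obtain ⟨hi, hle⟩ := integral_exp_noiseSq_add (pts_disjoint z xd t.1 t.2.1 t.2.2)
    (s := θ * (1 + τ) / 2) (by positivity) (by linarith)
  refine ⟨hi.const_mul _, ?_⟩
  unfold pairBound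
  rw [integral_const_mul]
  have : 1 - 2 * (θ * (1 + τ) / 2) = 1 - θ * (1 + τ) := by ring
  rw [this] at hle
  exact mul_le_mul_of_nonneg_left hle (by positivity)

end BlockRatios

section CoefficientRatios

variable {n N : ℕ} {z : Knot N → ℝ} {xd : Fin n → ℝ} {g : Knot N → ℝ → ℝ} {c₀ c₁ B₀ B : ℝ}

/-- The values at distance at least `√(m / |A|)` from the average of `f` on `A`. -/
def farSet (f : Fin n → ℝ) (A : Finset (Fin n)) (m : ℝ) : Set ℝ :=
  {b | m ≤ A.card * (b - avg f A) ^ 2}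

lemma measurableSet_farSet (f : Fin n → ℝ) (A : Finset (Fin n)) (m : ℝ) :
    MeasurableSet (farSet f A m) :=
  measurableSet_le measurable_const (by fun_prop)

/-- A lower bound for the normalised mass of any block of the grid. -/
def massFloor (n : ℕ) (B c₀ ρ s : ℝ) : ℝ :=
  s ^ B * min (c₀ * ρ * Real.exp (-(1 / 2))) 1 * (√((n : ℝ) + 1))⁻¹

lemma massFloor_pos (hc₀ : 0 < c₀) {ρ s : ℝ} (hρ : 0 < ρ) (hs : 0 < s) :
    0 < massFloor n B c₀ ρ s := by
  unfold massFloor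
  have := Real.rpow_pos_of_pos hs B
  have : 0 < min (c₀ * ρ * Real.exp (-(1 / 2))) 1 := lt_min (by positivity) one_pos
  positivity

lemma massFloor_le_one (hc₀ : 0 < c₀) (hB : 0 ≤ B) {ρ s : ℝ} (hρ : 0 < ρ) (hs : 0 < s)
    (hs1 : s ≤ 1) : massFloor n B c₀ ρ s ≤ 1 := by
  unfold massFloor
  have h1 := Real.rpow_le_one hs.le hs1 hB
  have h2 : min (c₀ * ρ * Real.exp (-(1 / 2))) 1 ≤ 1 := min_le_right _ _
  have h2' : 0 < min (c₀ * ρ * Real.exp (-(1 / 2))) 1 := lt_min (by positivity) one_pos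
  have h3 : (√((n : ℝ) + 1))⁻¹ ≤ 1 := by
    refine inv_le_one_of_one_le₀ ?_
    rw [Real.one_le_sqrt]
    linarith [(n.cast_nonneg : (0 : ℝ) ≤ n)]
  exact mul_le_one₀ (mul_le_one₀ h1 h2'.le h2) (by positivity) h3

lemma massFloor_mul_le_blockMass (hg : ∀ j, IsGoodDensity c₀ c₁ B₀ (g j))
    (hc₀ : 0 < c₀) (hB : 0 ≤ B) {ρ s : ℝ} (hρ : 0 < ρ) (hρ1 : ρ ≤ 1) (hs : 0 < s) (Y : Fin n → ℝ)
    {q : Knot N × Knot N} (hq : s ≤ z q.2 - z q.1) {v : ℝ} (hv : |v| + ρ ≤ B₀) :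
    massFloor n B c₀ ρ s * Real.exp (-(1 / 2) * ssq Y (pts xd z q) v) ≤
      blockMass xd z B g Y q := by
  have hL := marg_lower (hg q.2) Y (pts xd z q) hρ hρ1 hv
  have hcard : ((pts xd z q).card : ℝ) ≤ n := by
    exact_mod_cast (Finset.card_le_univ _).trans_eq (Fintype.card_fin n)
  unfold massFloor blockMass
  have h2 : 0 < min (c₀ * ρ * Real.exp (-(1 / 2))) 1 := lt_min (by positivity) one_pos
  calc _ = s ^ B * (min (c₀ * ρ * Real.exp (-(1 / 2))) 1 * (√((n : ℝ) + 1))⁻¹ *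
        Real.exp (-(1 / 2) * ssq Y (pts xd z q) v)) := by ring
    _ ≤ (z q.2 - z q.1) ^ B * (c₀ * ρ * Real.exp (-(1 / 2)) *
        (√((pts xd z q).card + 1))⁻¹ * Real.exp (-(1 / 2) * ssq Y (pts xd z q) v)) := by
      have := Real.rpow_nonneg (hs.le.trans hq) B
      gcongr
      exact min_le_left _ _
    _ ≤ _ := mul_le_mul_of_nonneg_left hL (Real.rpow_nonneg (hs.le.trans hq) B)

lemma pts_self (xd : Fin n → ℝ) (z : Knot N → ℝ) (i : Knot N) : pts xd z (i, i) = ∅ := by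
  ext a
  simp [mem_pts]

lemma massFloor_mul_le_extOne (hg : ∀ j, IsGoodDensity c₀ c₁ B₀ (g j))
    (hc₀ : 0 < c₀) (hB : 0 ≤ B) {ρ s : ℝ} (hρ : 0 < ρ) (hρ1 : ρ ≤ 1) (hs : 0 < s) (hs1 : s ≤ 1)
    (hsp : ∀ a b : Knot N, a < b → s ≤ z b - z a) (Y : Fin n → ℝ)
    {a b : Knot N} (hab : a ≤ b) {v : ℝ} (hv : |v| + ρ ≤ B₀) :
    massFloor n B c₀ ρ s * Real.exp (-(1 / 2) * ssq Y (pts xd z (a, b)) v) ≤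
      extOne (blockMass xd z B g Y) a b := by
  rcases hab.lt_or_eq with h | rfl
  · rw [extOne, if_pos h]
    exact massFloor_mul_le_blockMass hg hc₀ hB hρ hρ1 hs Y (hsp a b h) hv
  · rw [extOne, if_neg (lt_irrefl _), pts_self]
    simpa [ssq] using massFloor_le_one hc₀ hB hρ hs hs1

lemma integral_farSet_le (hz : StrictMono z) (hg : ∀ j, IsGoodDensity c₀ c₁ B₀ (g j))
    {i a b k : Knot N} (hia : i ≤ a) (hab : a < b) (hbk : b ≤ k) (f ε : Fin n → ℝ) (m : ℝ) :
    ∫ x, g k x * ((if x ∈ farSet f (pts xd z (a, b)) m then (1 : ℝ) else 0) *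
        Real.exp (-(1 / 2) * ssq (fun l => f l + ε l) (pts xd z (i, k)) x)) ≤
      Real.exp (-(1 / 2) * (ssq (fun l => f l + ε l) (pts xd z (i, a)) (avg f (pts xd z (i, a))) +
          ssq (fun l => f l + ε l) (pts xd z (a, b)) (avg f (pts xd z (a, b))) +
          ssq (fun l => f l + ε l) (pts xd z (b, k)) (avg f (pts xd z (b, k)))) +
        1 / 2 * (noiseSq (pts xd z (i, a)) ε + noiseSq (pts xd z (b, k)) ε +
          2 * noiseSq (pts xd z (a, b)) ε) - m / 4) := by
  refine integral_mul_le (hg k) (fun x => ?_) (fun x => ?_)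
  · exact mul_nonneg (by split_ifs <;> norm_num) (Real.exp_pos _).le
  · split_ifs with hx
    · rw [one_mul, Real.exp_le_exp, ssq_pts_add hz (hia.trans hab.le) hbk,
        ssq_pts_add hz hia hab.le]
      have h1 := ssq_avg_le' f ε (pts xd z (i, a)) x
      have h2 := ssq_avg_le f ε (pts xd z (a, b)) x
      have h3 := ssq_avg_le' f ε (pts xd z (b, k)) x
      have h4 : m ≤ (pts xd z (a, b)).card * (x - avg f (pts xd z (a, b))) ^ 2 := hx
      linarith
    · rw [zero_mul]
      exact (Real.exp_pos _).le

/-- The pointwise bound on the posterior mass of a block with an atypical coefficient. -/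
def coefBound (L m : ℝ) (xd : Fin n → ℝ) (z : Knot N → ℝ)
    (u : Knot N × Knot N × Knot N × Knot N) (ε : Fin n → ℝ) : ℝ :=
  L⁻¹ ^ 3 * Real.exp (-(m / 32)) *
    (Real.exp (3 / 16 * noiseSq (pts xd z (u.1, u.2.1)) ε) +
      Real.exp (3 / 16 * noiseSq (pts xd z (u.2.2.1, u.2.2.2)) ε) +
      Real.exp (3 / 8 * noiseSq (pts xd z (u.2.1, u.2.2.1)) ε))

lemma exp_add_add_le (x y w : ℝ) :
    Real.exp (x + y + w) ≤ Real.exp (3 * x) + Real.exp (3 * y) + Real.exp (3 * w) := by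
  have h1 := Real.exp_pos (3 * x)
  have h2 := Real.exp_pos (3 * y)
  have h3 := Real.exp_pos (3 * w)
  rcases le_total x y with h | h
  · rcases le_total y w with h' | h'
    · linarith [Real.exp_le_exp.mpr (show x + y + w ≤ 3 * w by linarith)]
    · linarith [Real.exp_le_exp.mpr (show x + y + w ≤ 3 * y by linarith)]
  · rcases le_total x w with h' | h'
    · linarith [Real.exp_le_exp.mpr (show x + y + w ≤ 3 * w by linarith)]
    · linarith [Real.exp_le_exp.mpr (show x + y + w ≤ 3 * x by linarith)]

lemma postCoef_le_coefBound (hz : StrictMono z) (h0 : z 0 = 0) (h1 : z (Fin.last N) = 1)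
    (hg : ∀ j, IsGoodDensity c₀ c₁ B₀ (g j)) (hc₀ : 0 < c₀) (hB : 0 ≤ B)
    {i a b k : Knot N} (hia : i ≤ a) (hab : a < b) (hbk : b ≤ k) (f ε : Fin n → ℝ)
    {ρ s : ℝ} (m : ℝ) (hρ : 0 < ρ) (hρ1 : ρ ≤ 1) (hs : 0 < s) (hs1 : s ≤ 1)
    (hsp : ∀ a b : Knot N, a < b → s ≤ z b - z a)
    (hf : ∀ q, |avg f (pts xd z q)| + ρ ≤ B₀) :
    postCoef xd z B g (fun l => f l + ε l) i k (farSet f (pts xd z (a, b)) m) ≤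
      coefBound (massFloor n B c₀ ρ s) m xd z (i, a, b, k) ε := by
  have hT := measurableSet_farSet f (pts xd z (a, b)) m
  have hI := integral_farSet_le (xd := xd) hz hg hia hab hbk f ε m
  have hL0 := massFloor_pos (n := n) (B := B) hc₀ hρ hs
  have hL1 := massFloor_le_one (n := n) hc₀ hB hρ hs hs1
  set Y : Fin n → ℝ := fun l => f l + ε l with hY
  have hA := massFloor_mul_le_extOne (xd := xd) hg hc₀ hB hρ hρ1 hs hs1 hsp Y hia (hf (i, a))
  have hW := massFloor_mul_le_blockMass (xd := xd) hg hc₀ hB hρ hρ1 hs Y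
    (q := (a, b)) (hsp a b hab) (hf (a, b))
  have hC := massFloor_mul_le_extOne (xd := xd) hg hc₀ hB hρ hρ1 hs hs1 hsp Y hbk (hf (b, k))
  set L := massFloor n B c₀ ρ s with hLdef
  set qA := ssq Y (pts xd z (i, a)) (avg f (pts xd z (i, a)))
  set qW := ssq Y (pts xd z (a, b)) (avg f (pts xd z (a, b)))
  set qC := ssq Y (pts xd z (b, k)) (avg f (pts xd z (b, k)))
  set X := 1 / 2 * (noiseSq (pts xd z (i, a)) ε + noiseSq (pts xd z (b, k)) ε +
          2 * noiseSq (pts xd z (a, b)) ε) - m / 4 with hX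
  have hik : i < k := hia.trans_lt (hab.trans_le hbk)
  have hlen0 : 0 ≤ z k - z i := by linarith [hz hik]
  have hlen : (z k - z i) ^ B ≤ 1 := by
    refine Real.rpow_le_one hlen0 ?_ hB
    linarith [hz.monotone (Fin.zero_le i), hz.monotone (Fin.le_last k)]
  have hprod : L ^ 3 * Real.exp (-(1 / 2) * (qA + qW + qC)) ≤
      extOne (blockMass xd z B g Y) i a * blockMass xd z B g Y (a, b) *
        extOne (blockMass xd z B g Y) b k := by
    calc _ = (L * Real.exp (-(1 / 2) * qA)) * (L * Real.exp (-(1 / 2) * qW)) *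
          (L * Real.exp (-(1 / 2) * qC)) := by
          rw [mul_add, mul_add, Real.exp_add, Real.exp_add]; ring
      _ ≤ _ := by
          have hA0 : 0 ≤ extOne (blockMass xd z B g Y) i a := le_trans (by positivity) hA
          have hW0 : 0 ≤ blockMass xd z B g Y (a, b) := le_trans (by positivity) hW
          gcongr
  have hr : postCoef xd z B g Y i k (farSet f (pts xd z (a, b)) m) ≤ L⁻¹ ^ 3 * Real.exp X := by
    refine postCoef_le hz h0 h1 hg hia hab hbk hT (by positivity) ?_
    calc _ ≤ (z k - z i) ^ B * Real.exp (-(1 / 2) * (qA + qW + qC) + X) := by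
          refine mul_le_mul_of_nonneg_left (hI.trans_eq ?_) (Real.rpow_nonneg hlen0 B)
          rw [hX]; ring_nf
      _ ≤ Real.exp (-(1 / 2) * (qA + qW + qC) + X) :=
          mul_le_of_le_one_left (Real.exp_pos _).le hlen
      _ = L⁻¹ ^ 3 * Real.exp X * (L ^ 3 * Real.exp (-(1 / 2) * (qA + qW + qC))) := by
          rw [Real.exp_add]
          field_simp
      _ ≤ _ := mul_le_mul_of_nonneg_left hprod (by positivity)
  refine (le_rpow_of_le_of_le_one (postCoef_nonneg hz _ _ _) (postCoef_le_one hz hg _ _ hT) hr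
    (θ := 1 / 8) (by norm_num) (by norm_num)).trans ?_
  have hL3 : 1 ≤ L⁻¹ ^ 3 := one_le_pow₀ ((one_le_inv₀ hL0).mpr hL1)
  rw [Real.mul_rpow (by positivity) (Real.exp_pos _).le, ← Real.exp_mul]
  have e1 : (L⁻¹ ^ 3 : ℝ) ^ (1 / 8 : ℝ) ≤ L⁻¹ ^ 3 := by
    conv_rhs => rw [← Real.rpow_one (L⁻¹ ^ 3)]
    exact Real.rpow_le_rpow_of_exponent_le hL3 (by norm_num)
  have e2 : Real.exp (X * (1 / 8)) ≤ Real.exp (-(m / 32)) *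
      (Real.exp (3 / 16 * noiseSq (pts xd z (i, a)) ε) +
      Real.exp (3 / 16 * noiseSq (pts xd z (b, k)) ε) +
      Real.exp (3 / 8 * noiseSq (pts xd z (a, b)) ε)) := by
    have := exp_add_add_le (1 / 16 * noiseSq (pts xd z (i, a)) ε)
      (1 / 16 * noiseSq (pts xd z (b, k)) ε) (1 / 8 * noiseSq (pts xd z (a, b)) ε)
    have hX8 : X * (1 / 8) = -(m / 32) + (1 / 16 * noiseSq (pts xd z (i, a)) ε +
      1 / 16 * noiseSq (pts xd z (b, k)) ε + 1 / 8 * noiseSq (pts xd z (a, b)) ε) := by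
      rw [hX]; ring
    rw [hX8, Real.exp_add]
    refine mul_le_mul_of_nonneg_left (this.trans_eq ?_) (Real.exp_pos _).le
    ring_nf
  unfold coefBound
  rw [mul_assoc]
  exact mul_le_mul e1 e2 (Real.exp_pos _).le (by positivity)

lemma integral_coefBound {L : ℝ} (hL : 0 < L) (m : ℝ) (u : Knot N × Knot N × Knot N × Knot N) :
    Integrable (coefBound L m xd z u) (regNoise n) ∧
    ∫ ε, coefBound L m xd z u ε ∂regNoise n ≤ L⁻¹ ^ 3 * Real.exp (-(m / 32)) * 8 := by
  obtain ⟨hi1, hl1⟩ := integral_exp_noiseSq (pts xd z (u.1, u.2.1)) (s := 3 / 16)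
    (by norm_num) (by norm_num)
  obtain ⟨hi2, hl2⟩ := integral_exp_noiseSq (pts xd z (u.2.2.1, u.2.2.2)) (s := 3 / 16)
    (by norm_num) (by norm_num)
  obtain ⟨hi3, hl3⟩ := integral_exp_noiseSq (pts xd z (u.2.1, u.2.2.1)) (s := 3 / 8)
    (by norm_num) (by norm_num)
  refine ⟨((hi1.add hi2).add hi3).const_mul _, ?_⟩
  unfold coefBound
  have h12 := hi1.add hi2
  simp only [Pi.add_def] at h12
  rw [integral_const_mul, integral_add h12 hi3, integral_add hi1 hi2]
  refine mul_le_mul_of_nonneg_left ?_ (by positivity)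
  norm_num at hl1 hl2 hl3 ⊢
  linarith

end CoefficientRatios

section Windows

variable {n N : ℕ} {z : Knot N → ℝ} {S : Finset (Knot N)} {xd : Fin n → ℝ}

lemma exists_knot_near (h0 : z 0 = 0) (h1 : z (Fin.last N) = 1) {G : ℝ} (hG : 0 ≤ G)
    (hgap : ∀ i : Fin N, z i.succ - z i.castSucc ≤ G) {y : ℝ} (hy : y ∈ Icc (0 : ℝ) 1) :
    ∃ w, y ≤ z w ∧ z w ≤ y + G := by
  have hne : (Finset.univ.filter fun w : Knot N => y ≤ z w).Nonempty :=
    ⟨Fin.last N, by simp [h1, hy.2]⟩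
  obtain ⟨w, hw, hmin⟩ := Finset.exists_minimal hne
  simp only [Finset.mem_filter, Finset.mem_univ, true_and] at hw hmin
  refine ⟨w, hw, ?_⟩
  rcases Fin.eq_zero_or_eq_succ w with rfl | ⟨i, rfl⟩
  · rw [h0]; linarith [hy.1]
  · have hlt : z i.castSucc < y := by
      by_contra hcon
      exact absurd (hmin (not_lt.mp hcon) (Fin.castSucc_lt_succ).le)
        (not_le.mpr Fin.castSucc_lt_succ)
    linarith [hgap i]

lemma exists_window (hz : StrictMono z) (h0 : z 0 = 0) (h1 : z (Fin.last N) = 1) {G : ℝ}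
    (hG : 0 ≤ G) (hgap : ∀ i : Fin N, z i.succ - z i.castSucc ≤ G) {a b : Knot N} {p ℓ : ℝ}
    (hp : p ∈ Icc (z a) (z b)) (hℓ : 0 < ℓ) (hab : ℓ ≤ z b - z a) (hGℓ : 8 * G ≤ ℓ) :
    ∃ w₁ w₂, a ≤ w₁ ∧ w₁ < w₂ ∧ w₂ ≤ b ∧ p - ℓ ≤ z w₁ ∧ z w₂ ≤ p + ℓ ∧ ℓ / 8 ≤ z w₂ - z w₁ := by
  have ha := hz.monotone (Fin.zero_le a)
  have hb := hz.monotone (Fin.le_last b)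
  rw [h0] at ha
  rw [h1] at hb
  obtain ⟨hp1, hp2⟩ := hp
  rcases le_total (ℓ / 2) (z b - p) with h | h
  · obtain ⟨w₁, h11, h12⟩ := exists_knot_near h0 h1 hG hgap (y := p) ⟨by linarith, by linarith⟩
    obtain ⟨w₂, h21, h22⟩ := exists_knot_near h0 h1 hG hgap (y := p + ℓ / 4)
      ⟨by linarith, by linarith⟩
    refine ⟨w₁, w₂, hz.le_iff_le.mp (by linarith), hz.lt_iff_lt.mp (by linarith),
      hz.le_iff_le.mp (by linarith), by linarith, by linarith, by linarith⟩
  · obtain ⟨w₁, h11, h12⟩ := exists_knot_near h0 h1 hG hgap (y := p - ℓ / 2)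
      ⟨by linarith, by linarith⟩
    obtain ⟨w₂, h21, h22⟩ := exists_knot_near h0 h1 hG hgap (y := p - ℓ / 4)
      ⟨by linarith, by linarith⟩
    refine ⟨w₁, w₂, hz.le_iff_le.mp (by linarith), hz.lt_iff_lt.mp (by linarith),
      hz.le_iff_le.mp (by linarith), by linarith, by linarith, by linarith⟩

lemma exists_consec_right (hS : IsPart N S) {k : Knot N} (hk : k ∈ S) (hlast : k ≠ Fin.last N) :
    ∃ m, Consec N S k m := by
  have hne : (S.filter fun w => k < w).Nonempty :=
    ⟨Fin.last N, by simp [hS.2, Fin.lt_last_iff_ne_last, hlast]⟩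
  obtain ⟨m, hm, hmin⟩ := Finset.exists_minimal hne
  simp only [Finset.mem_filter] at hm hmin
  exact ⟨m, hk, hm.1, hm.2, fun w hw hc =>
    absurd (hmin ⟨hw, hc.1⟩ hc.2.le) (not_le.mpr hc.2)⟩

lemma exists_consec_left (hS : IsPart N S) {i : Knot N} (hi : i ∈ S) (hzero : i ≠ 0) :
    ∃ m, Consec N S m i := by
  have hne : (S.filter fun w => w < i).Nonempty :=
    ⟨0, by simp [hS.1, Fin.pos_iff_ne_zero, hzero]⟩
  obtain ⟨m, hm, hmax⟩ := Finset.exists_maximal hne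
  simp only [Finset.mem_filter] at hm hmax
  exact ⟨m, hm.1, hi, hm.2, fun w hw hc =>
    absurd (hmax ⟨hw, hc.2⟩ hc.1.le) (not_le.mpr hc.1)⟩

lemma abs_avg_sub_le {f : Fin n → ℝ} {A : Finset (Fin n)} (hA : A.Nonempty) {c e : ℝ}
    (h : ∀ i ∈ A, |f i - c| ≤ e) : |avg f A - c| ≤ e := by
  have hc : (0 : ℝ) < A.card := by exact_mod_cast hA.card_pos
  have : avg f A - c = (∑ i ∈ A, (f i - c)) / A.card := by
    rw [avg, Finset.sum_sub_distrib, Finset.sum_const, nsmul_eq_mul]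
    field_simp
  rw [this, abs_div, abs_of_pos hc, div_le_iff₀ hc, mul_comm]
  calc _ ≤ ∑ i ∈ A, |f i - c| := Finset.abs_sum_le_sum_abs _ _
    _ ≤ A.card • e := Finset.sum_le_card_nsmul _ _ _ h
    _ = _ := nsmul_eq_mul _ _

lemma abs_avg_le {f : Fin n → ℝ} {A : Finset (Fin n)} {e : ℝ} (he : 0 ≤ e)
    (h : ∀ i ∈ A, |f i| ≤ e) : |avg f A| ≤ e := by
  rcases A.eq_empty_or_nonempty with rfl | hA
  · simpa [avg] using he
  · simpa using abs_avg_sub_le (c := 0) hA (by simpa using h)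

lemma card_pts_mono (hz : StrictMono z) {i a b k : Knot N} (hia : i ≤ a) (hbk : b ≤ k) :
    (pts xd z (a, b)).card ≤ (pts xd z (i, k)).card := by
  refine Finset.card_le_card fun l hl => ?_
  rw [mem_pts] at hl ⊢
  exact Ioc_subset_Ioc (hz.monotone hia) (hz.monotone hbk) hl

lemma pts_subset_Icc (hz : StrictMono z) (h0 : z 0 = 0) (h1 : z (Fin.last N) = 1)
    {q : Knot N × Knot N} {l : Fin n} (hl : l ∈ pts xd z q) : xd l ∈ Icc (0 : ℝ) 1 := by
  rw [mem_pts] at hl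
  have ha := hz.monotone (Fin.zero_le q.1)
  have hb := hz.monotone (Fin.le_last q.2)
  rw [h0] at ha
  rw [h1] at hb
  exact ⟨ha.trans hl.1.le, hl.2.trans hb⟩

/-- The local assumptions on design, grid and regression function near `x`, at bandwidth `h`
and rate `e`. -/
structure LocalSetup (xd : Fin n → ℝ) (z : Knot N → ℝ) (f₀ : ℝ → ℝ)
    (κ₀ κ₁ G D A h e L x : ℝ) : Prop where
  mono : StrictMono z
  zero : z 0 = 0
  one : z (Fin.last N) = 1
  G_nonneg : 0 ≤ G
  gap : ∀ i : Fin N, z i.succ - z i.castSucc ≤ G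
  kappa_pos : 0 < κ₀
  card_lower : ∀ a b : Knot N, a < b → D ≤ z b - z a →
    κ₀ * n * (z b - z a) ≤ (pts xd z (a, b)).card
  card_upper : ∀ a b : Knot N, a < b → ∀ d, D ≤ d → z b - z a ≤ d →
    ((pts xd z (a, b)).card : ℝ) ≤ κ₁ * n * d
  h_pos : 0 < h
  e_pos : 0 < e
  A_nonneg : 0 ≤ A
  L_pos : 0 < L
  rate : n * h * e ^ 2 = L
  holder : ∀ y ∈ Icc (0 : ℝ) 1, |y - x| ≤ 2 * h → |f₀ y - f₀ x| ≤ A * e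

variable {f₀ : ℝ → ℝ} {κ₀ κ₁ G D A h e L x : ℝ}

lemma LocalSetup.abs_avg_sub_le (H : LocalSetup xd z f₀ κ₀ κ₁ G D A h e L x)
    {q : Knot N × Knot N} (hne : (pts xd z q).Nonempty) (h1 : x - 2 * h ≤ z q.1)
    (h2 : z q.2 ≤ x + 2 * h) :
    |avg (fun l => f₀ (xd l)) (pts xd z q) - f₀ x| ≤ A * e := by
  refine Spatial.abs_avg_sub_le hne fun l hl => H.holder _ (pts_subset_Icc H.mono H.zero H.one hl) ?_
  rw [mem_pts] at hl
  exact abs_le.mpr ⟨by linarith [hl.1], by linarith [hl.2]⟩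

/-- A window of length at least `δ h / 8` near `p` inside a block of length at least `δ h`. -/
lemma LocalSetup.exists_window (H : LocalSetup xd z f₀ κ₀ κ₁ G D A h e L x) {δ : ℝ} (hδ : 0 < δ)
    (hδ1 : δ ≤ 1)
    (hD : 8 * D ≤ δ * h) (hG : 8 * G ≤ δ * h) {a b : Knot N} {p : ℝ} (hp : p ∈ Icc (z a) (z b))
    (hab : δ * h ≤ z b - z a) (hpx : |p - x| ≤ h) :
    ∃ w₁ w₂, a ≤ w₁ ∧ w₁ < w₂ ∧ w₂ ≤ b ∧
      κ₀ * δ / 8 * (n * h) ≤ (pts xd z (w₁, w₂)).card ∧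
      |avg (fun l => f₀ (xd l)) (pts xd z (w₁, w₂)) - f₀ x| ≤ A * e := by
  have hδh : 0 < δ * h := mul_pos hδ H.h_pos
  have hδh1 : δ * h ≤ h := mul_le_of_le_one_left H.h_pos.le hδ1
  obtain ⟨w₁, w₂, h1, h2, h3, h4, h5, h6⟩ :=
    Spatial.exists_window H.mono H.zero H.one H.G_nonneg H.gap hp hδh hab hG
  have hcard := H.card_lower w₁ w₂ h2 (by linarith)
  have hn : (0 : ℝ) < n := by
    rcases (Nat.cast_nonneg (α := ℝ) n).lt_or_eq with h' | h'
    · exact h'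
    · have := H.rate
      rw [← h', zero_mul, zero_mul] at this
      exact absurd this H.L_pos.ne
  have hκn : 0 < κ₀ * n := mul_pos H.kappa_pos hn
  have hge : κ₀ * δ / 8 * (n * h) ≤ (pts xd z (w₁, w₂)).card := by
    have := mul_le_mul_of_nonneg_left h6 hκn.le
    nlinarith
  rw [abs_le] at hpx
  refine ⟨w₁, w₂, h1, h2, h3, hge, H.abs_avg_sub_le ?_ ?_ ?_⟩
  · rw [← Finset.card_pos]
    have h' : (0 : ℝ) < κ₀ * δ / 8 * (n * h) := by
      have := H.kappa_pos
      have := H.h_pos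
      positivity
    exact_mod_cast h'.trans_le hge
  · dsimp only; linarith [hpx.1]
  · dsimp only; linarith [hpx.2]

lemma sq_le_of_card_mul_sq_lt {N' K n' h e L Λ y : ℝ} (hK : 0 < K) (hnh : 0 < n' * h)
    (hrate : n' * h * e ^ 2 = L) (hN : K * (n' * h) ≤ N') (hy : N' * y ^ 2 ≤ Λ * L) :
    y ^ 2 ≤ Λ / K * e ^ 2 := by
  have h1 : K * (n' * h) * y ^ 2 ≤ Λ * (n' * h * e ^ 2) := by
    rw [hrate]
    exact (mul_le_mul_of_nonneg_right hN (sq_nonneg y)).trans hy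
  have h2 : K * y ^ 2 ≤ Λ * e ^ 2 := by
    by_contra hcon
    have := mul_lt_mul_of_pos_left (not_le.mp hcon) hnh
    linarith
  rw [div_mul_eq_mul_div, le_div_iff₀ hK]
  linarith

lemma abs_le_sqrt_mul {K e y : ℝ} (he : 0 ≤ e) (h : y ^ 2 ≤ K * e ^ 2) : |y| ≤ √K * e := by
  rcases le_or_gt 0 K with hK | hK
  · refine abs_le_of_sq_le_sq (h.trans_eq ?_) (by positivity)
    rw [mul_pow, Real.sq_sqrt hK]
  · have : y ^ 2 ≤ 0 := h.trans (mul_nonpos_of_nonpos_of_nonneg hK.le (sq_nonneg e))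
    have : y = 0 := by nlinarith [sq_nonneg y]
    rw [this, abs_zero]
    positivity

lemma LocalSetup.n_pos (H : LocalSetup xd z f₀ κ₀ κ₁ G D A h e L x) : (0 : ℝ) < n := by
  rcases (Nat.cast_nonneg (α := ℝ) n).lt_or_eq with h' | h'
  · exact h'
  · have := H.rate
    rw [← h', zero_mul, zero_mul] at this
    exact absurd this H.L_pos.ne

/-- On a long block, a typical coefficient is close to the signal. -/
lemma LocalSetup.abs_sub_le_of_long (H : LocalSetup xd z f₀ κ₀ κ₁ G D A h e L x) {δ Λ : ℝ}
    (hδ : 0 < δ) (hδ1 : δ ≤ 1) (hD : 8 * D ≤ δ * h) (hG : 8 * G ≤ δ * h) {i k : Knot N} {b : ℝ}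
    (hb : ∀ a b', i ≤ a → a < b' → b' ≤ k → (pts xd z (a, b')).card *
      (b - avg (fun l => f₀ (xd l)) (pts xd z (a, b'))) ^ 2 ≤ Λ * L)
    (hx : x ∈ Icc (z i) (z k)) (hlong : δ * h ≤ z k - z i) :
    |b - f₀ x| ≤ (A + √(Λ / (κ₀ * δ / 8))) * e := by
  obtain ⟨w₁, w₂, h1, h2, h3, h4, h5⟩ := H.exists_window hδ hδ1 hD hG hx hlong
    (by simpa using H.h_pos.le)
  have hK : 0 < κ₀ * δ / 8 := by have := H.kappa_pos; positivity
  have := abs_le_sqrt_mul H.e_pos.le (sq_le_of_card_mul_sq_lt hK (mul_pos H.n_pos H.h_pos) H.rate h4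
    (hb w₁ w₂ h1 h2 h3))
  calc _ ≤ _ := abs_sub_le _ (avg (fun l => f₀ (xd l)) (pts xd z (w₁, w₂))) _
    _ ≤ _ := by linarith

/-- The averages of the signal on two adjacent blocks, one of them short, are close. -/
lemma LocalSetup.exists_common_value (H : LocalSetup xd z f₀ κ₀ κ₁ G D A h e L x)
    {δ Λ b₀ : ℝ} (hδ : 0 < δ) (hδ1 : δ ≤ 1) (hD : 8 * D ≤ δ * h) (hG : 8 * G ≤ δ * h)
    (hκ₁ : 0 ≤ κ₁)
    (hb₀ : ∀ q, |avg (fun l => f₀ (xd l)) (pts xd z q)| ≤ b₀) {q r : Knot N × Knot N}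
    (hq : q.1 < q.2) (hr : r.1 < r.2) (hx : x ∈ Icc (z q.1) (z q.2)) (hshort : z q.2 - z q.1 ≤ δ * h)
    {p : ℝ} (hp : p ∈ Icc (z r.1) (z r.2)) (hpx : |p - x| ≤ h) {b : ℝ}
    (hb : ∀ a b', r.1 ≤ a → a < b' → b' ≤ r.2 → (pts xd z (a, b')).card *
      (b - avg (fun l => f₀ (xd l)) (pts xd z (a, b'))) ^ 2 ≤ Λ * L) :
    ∃ v, |v| ≤ b₀ ∧ (pts xd z q).card * (v - avg (fun l => f₀ (xd l)) (pts xd z q)) ^ 2 +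
      (pts xd z r).card * (v - avg (fun l => f₀ (xd l)) (pts xd z r)) ^ 2 ≤
      κ₁ * δ * (2 * A + 2 * √(Λ / (κ₀ / 8))) ^ 2 * L := by
  have hn := H.n_pos
  have hh := H.h_pos
  have he := H.e_pos
  have hA := H.A_nonneg
  have hL := H.L_pos
  have hδh1 : δ * h ≤ h := mul_le_of_le_one_left hh.le hδ1
  set fb := avg (fun l => f₀ (xd l)) with hfb
  have hR : 0 ≤ κ₁ * δ * (2 * A + 2 * √(Λ / (κ₀ / 8))) ^ 2 * L := by positivity
  rcases (pts xd z r).eq_empty_or_nonempty with hre | hre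
  · exact ⟨fb (pts xd z q), hb₀ q, by simpa [hre] using hR⟩
  refine ⟨fb (pts xd z r), hb₀ r, ?_⟩
  rcases (pts xd z q).eq_empty_or_nonempty with hqe | hqe
  · simpa [hqe] using hR
  have hcard := H.card_upper q.1 q.2 hq (δ * h)
    (by linarith [H.G_nonneg, mul_pos hδ hh]) hshort
  have hqx : |fb (pts xd z q) - f₀ x| ≤ A * e :=
    H.abs_avg_sub_le hqe (by linarith [hx.1, hx.2]) (by linarith [hx.1, hx.2])
  have hpx' := abs_le.mp hpx
  have hrx : |fb (pts xd z r) - f₀ x| ≤ (A + 2 * √(Λ / (κ₀ / 8))) * e := by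
    rcases le_or_gt (z r.2 - z r.1) h with hle | hgt
    · have h1 : |fb (pts xd z r) - f₀ x| ≤ A * e :=
        H.abs_avg_sub_le hre (by linarith [hp.1, hp.2]) (by linarith [hp.1, hp.2])
      have : 0 ≤ √(Λ / (κ₀ / 8)) * e := by positivity
      linarith
    · obtain ⟨w₁, w₂, h1, h2, h3, h4, h5⟩ := H.exists_window one_pos le_rfl (by linarith)
        (by linarith) hp (by linarith) hpx
      have hK : 0 < κ₀ * 1 / 8 := by have := H.kappa_pos; positivity
      have hw := abs_le_sqrt_mul he.le (sq_le_of_card_mul_sq_lt hK (mul_pos hn hh) H.rate h4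
        (hb w₁ w₂ h1 h2 h3))
      have hmono : ((pts xd z (w₁, w₂)).card : ℝ) ≤ (pts xd z (r.1, r.2)).card := by
        exact_mod_cast card_pts_mono H.mono h1 h3
      have hw' := abs_le_sqrt_mul he.le (sq_le_of_card_mul_sq_lt hK (mul_pos hn hh) H.rate
        (h4.trans hmono) (hb r.1 r.2 le_rfl hr le_rfl))
      rw [mul_one] at hw hw'
      rw [abs_le] at *
      constructor <;> linarith [hw.1, hw.2, hw'.1, hw'.2, h5.1, h5.2]
  have hdiff : |fb (pts xd z r) - fb (pts xd z q)| ≤ (2 * A + 2 * √(Λ / (κ₀ / 8))) * e := by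
    rw [abs_le] at *
    constructor <;> linarith [hrx.1, hrx.2, hqx.1, hqx.2]
  have hsq : (fb (pts xd z r) - fb (pts xd z q)) ^ 2 ≤
      ((2 * A + 2 * √(Λ / (κ₀ / 8))) * e) ^ 2 := by
    rw [← sq_abs]
    exact pow_le_pow_left₀ (abs_nonneg _) hdiff 2
  calc _ = (pts xd z q).card * (fb (pts xd z r) - fb (pts xd z q)) ^ 2 := by simp
    _ ≤ κ₁ * n * (δ * h) * ((2 * A + 2 * √(Λ / (κ₀ / 8))) * e) ^ 2 :=
      mul_le_mul hcard hsq (sq_nonneg _) (by positivity)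
    _ = κ₁ * δ * (2 * A + 2 * √(Λ / (κ₀ / 8))) ^ 2 * (n * h * e ^ 2) := by ring
    _ = _ := by rw [H.rate]

/-- If all the coefficients are typical but the step function is far from the signal at `x`, then
there are two adjacent blocks, one of them short, with close averages. -/
lemma LocalSetup.exists_mergeable (H : LocalSetup xd z f₀ κ₀ κ₁ G D A h e L x)
    {δ Λ b₀ : ℝ} (hδ : 0 < δ) (hδ1 : δ ≤ 1) (hD : 8 * D ≤ δ * h) (hG : 8 * G ≤ δ * h)
    (hκ₁ : 0 ≤ κ₁) (hh1 : h < 1)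
    (hb₀ : ∀ q, |avg (fun l => f₀ (xd l)) (pts xd z q)| ≤ b₀) (hS : IsPart N S)
    {β : Knot N → ℝ}
    (hβ : ∀ i a b k, Consec N S i k → i ≤ a → a < b → b ≤ k → (pts xd z (a, b)).card *
      (β k - avg (fun l => f₀ (xd l)) (pts xd z (a, b))) ^ 2 ≤ Λ * L)
    (hx : x ∈ Ioc (0 : ℝ) 1)
    (hfar : (A + √(Λ / (κ₀ * δ / 8))) * e < |fPart N z S β x - f₀ x|) :
    ∃ i j k, Consec N S i j ∧ Consec N S j k ∧ min (z j - z i) (z k - z j) ≤ h ∧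
      ∃ v, |v| ≤ b₀ ∧ mergeLoss (fun l => f₀ (xd l)) xd z i j k v ≤
        κ₁ * δ * (2 * A + 2 * √(Λ / (κ₀ / 8))) ^ 2 * L := by
  obtain ⟨i, k, hik, hxik⟩ := exists_block H.zero H.one hS hx
  rw [fPart_eq H.mono β hik hxik] at hfar
  have hxI : x ∈ Icc (z i) (z k) := ⟨hxik.1.le, hxik.2⟩
  have hδh1 : δ * h ≤ h := mul_le_of_le_one_left H.h_pos.le hδ1
  have hshort : z k - z i < δ * h := by
    by_contra hcon
    exact absurd (H.abs_sub_le_of_long hδ hδ1 hD hG (fun a b' => hβ i a b' k hik) hxI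
      (not_lt.mp hcon)) (not_le.mpr hfar)
  by_cases hlast : k = Fin.last N
  · have hi0 : i ≠ 0 := by
      rintro rfl
      rw [hlast, H.zero, H.one] at hshort
      linarith
    obtain ⟨m, hm⟩ := exists_consec_left hS hik.1 hi0
    obtain ⟨v, hv, hle⟩ := H.exists_common_value hδ hδ1 hD hG hκ₁ hb₀ (q := (i, k))
      (r := (m, i)) hik.2.2.1 hm.2.2.1 hxI hshort.le (p := z i) ⟨(H.mono hm.2.2.1).le, le_rfl⟩
      (abs_le.mpr ⟨by linarith [hxI.1, hxI.2], by linarith [hxI.1, H.h_pos]⟩)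
      (fun a b' => hβ m a b' i hm)
    exact ⟨m, i, k, hm, hik, (min_le_right _ _).trans (by linarith), v, hv, by
      rw [mergeLoss]; linarith⟩
  · obtain ⟨m, hm⟩ := exists_consec_right hS hik.2.1 hlast
    obtain ⟨v, hv, hle⟩ := H.exists_common_value hδ hδ1 hD hG hκ₁ hb₀ (q := (i, k))
      (r := (k, m)) hik.2.2.1 hm.2.2.1 hxI hshort.le (p := z k) ⟨le_rfl, (H.mono hm.2.2.1).le⟩
      (abs_le.mpr ⟨by linarith [hxI.2, H.h_pos], by linarith [hxI.1, hxI.2]⟩)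
      (fun a b' => hβ k a b' m hm)
    exact ⟨i, k, m, hik, hm, (min_le_left _ _).trans (by linarith), v, hv, hle⟩

end Windows

section Design

variable {n N : ℕ} {z : Knot N → ℝ} {xd : Fin n → ℝ}

lemma IsGrid.gap_pos {C₁ C₂ : ℝ} (h : IsGrid n N z C₁ C₂) (hC₁ : 0 < C₁) (hn : 2 ≤ n)
    (i : Fin N) : 0 < z i.succ - z i.castSucc := by
  have hn' : (2 : ℝ) ≤ n := by exact_mod_cast hn
  have : 0 < Real.log n := Real.log_pos (by linarith)
  exact lt_of_lt_of_le (by positivity) (h.2.2 i).1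

lemma IsGrid.strictMono {C₁ C₂ : ℝ} (h : IsGrid n N z C₁ C₂) (hC₁ : 0 < C₁) (hn : 2 ≤ n) :
    StrictMono z :=
  Fin.strictMono_iff_lt_succ.mpr fun i => by linarith [h.gap_pos hC₁ hn i]

lemma IsGrid.le_sub {C₁ C₂ : ℝ} (h : IsGrid n N z C₁ C₂) (hC₁ : 0 < C₁) (hn : 2 ≤ n)
    {a b : Knot N} (hab : a < b) : C₁ * Real.log n / n ≤ z b - z a := by
  obtain ⟨i, rfl⟩ := Fin.exists_castSucc_eq.mpr (Fin.ne_last_of_lt hab)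
  have h1 : i.succ ≤ b := Fin.castSucc_lt_iff_succ_le.mp hab
  linarith [(h.2.2 i).1, (h.strictMono hC₁ hn).monotone h1]

lemma IsGrid.card_le {C₁ C₂ : ℝ} (h : IsGrid n N z C₁ C₂) : N * (C₁ * Real.log n / n) ≤ 1 := by
  have hsum : ∑ i : Fin N, (z i.succ - z i.castSucc) = 1 := by
    have := Fin.sum_univ_succ z
    have h2 := Fin.sum_univ_castSucc z
    rw [Finset.sum_sub_distrib]
    rw [h.1] at this
    rw [h.2.1] at h2
    linarith
  calc _ = ∑ _i : Fin N, C₁ * Real.log n / n := by simp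
    _ ≤ ∑ i : Fin N, (z i.succ - z i.castSucc) := Finset.sum_le_sum fun i _ => (h.2.2 i).1
    _ = 1 := hsum

lemma abs_card_sub_le {pI : ℝ → ℝ → ℝ} {u₁ : ℝ} (hz : StrictMono z)
    (hΩ : ∀ ℓ : Knot N, ℓ ≠ 0 → OmegaX n N xd z pI u₁ (z ℓ)) {i j : Knot N} (hij : i < j) :
    |((pts xd z (i, j)).card : ℝ) - n * pI (z i) (z j)| ≤
      u₁ * √(Real.log n * (n * pI (z i) (z j))) := by
  refine hΩ j (ne_of_gt ((Fin.zero_le i).trans_lt hij)) (i, j)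
    ⟨{0, i, j, Fin.last N}, ⟨by simp, by simp⟩, ⟨by simp, by simp, hij, ?_⟩,
      Or.inl ⟨hz hij, le_rfl⟩⟩
  intro m hm hc
  simp only [Finset.mem_insert, Finset.mem_singleton] at hm
  rcases hm with rfl | rfl | rfl | rfl
  · exact absurd hc.1 (not_lt.mpr (Fin.zero_le i))
  · exact lt_irrefl _ hc.1
  · exact lt_irrefl _ hc.2
  · exact absurd hc.2 (not_lt.mpr (Fin.le_last j))

lemma LocalSetup.of_design {C₁ C₂ p₀ p₁ u₁ t₁ emin Mmax x : ℝ} {t M η f₀ : ℝ → ℝ}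
    {pI : ℝ → ℝ → ℝ}
    (hgrid : IsGrid n N z C₁ C₂) (hC₁ : 0 < C₁) (hC₁₂ : C₁ ≤ C₂) (hn : 2 ≤ n)
    (hp₀ : 0 < p₀) (hp₀₁ : p₀ ≤ p₁) (hu₁ : 0 < u₁)
    (hpI : ∀ a b : ℝ, a ≤ b → p₀ * (b - a) ≤ pI a b ∧ pI a b ≤ p₁ * (b - a))
    (hΩ : ∀ ℓ : Knot N, ℓ ≠ 0 → OmegaX n N xd z pI u₁ (z ℓ))
    (ht₁ : 0 < t₁) (htl : t₁ ≤ t x) (htu : t x ≤ 1) (hMmax : 0 < Mmax) (hM : M x ≤ Mmax)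
    (hη : emin ≤ η x) (hf₀ : HolderAt f₀ (t x) (M x) (η x) x)
    (hr1 : 1 ≤ (n : ℝ) / Real.log n)
    (hr2 : 2 * ((n : ℝ) / Real.log n) ^ (-(1 / 3) : ℝ) ≤ emin) :
    ∃ h, LocalSetup xd z f₀ (p₀ / 2) (3 / 2 * p₁) (C₂ * Real.log n / n)
        (4 * u₁ ^ 2 / p₀ * Real.log n / n) (2 * Mmax) h (epsn t n x) (Real.log n) x ∧
      h ≤ ((n : ℝ) / Real.log n) ^ (-(1 / 3) : ℝ) ∧
      ((n : ℝ) / Real.log n) ^ (-(1 / (2 * t₁ + 1))) ≤ h := by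
  have hn' : (2 : ℝ) ≤ n := by exact_mod_cast hn
  have hL : 0 < Real.log n := Real.log_pos (by linarith)
  have hn0 : (0 : ℝ) < n := by linarith
  have hz := hgrid.strictMono hC₁ hn
  have ht0 : 0 < t x := ht₁.trans_le htl
  set r := (n : ℝ) / Real.log n with hr
  have hr0 : 0 < r := by positivity
  have hh3 : r ^ (-(1 / (2 * t x + 1))) ≤ r ^ (-(1 / 3) : ℝ) := by
    refine Real.rpow_le_rpow_of_exponent_le hr1 (neg_le_neg ?_)
    exact one_div_le_one_div_of_le (by linarith) (by linarith)
  have hht : (r ^ (-(1 / (2 * t x + 1)))) ^ t x = epsn t n x := by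
    rw [← Real.rpow_mul hr0.le, epsn]
    congr 1
    ring
  refine ⟨r ^ (-(1 / (2 * t x + 1))), ?_, hh3, ?_⟩
  swap
  · refine Real.rpow_le_rpow_of_exponent_le hr1 (neg_le_neg ?_)
    exact one_div_le_one_div_of_le (by linarith) (by linarith)
  set h := r ^ (-(1 / (2 * t x + 1))) with hh
  have hh0 : 0 < h := Real.rpow_pos_of_pos hr0 _
  refine ⟨hz, hgrid.1, hgrid.2.1, ?_, fun i => (hgrid.2.2 i).2, by linarith, ?_, ?_, hh0,
    Real.rpow_pos_of_pos hr0 _, by linarith, hL, ?_, ?_⟩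
  · have : 0 < C₂ := hC₁.trans_le hC₁₂
    positivity
  · intro a b hab hD
    have hlen : 0 < z b - z a := by linarith [hz hab]
    have hc := (abs_le.mp (abs_card_sub_le hz hΩ hab)).1
    obtain ⟨hp1, -⟩ := hpI (z a) (z b) (hz hab).le
    set P := (n : ℝ) * pI (z a) (z b) with hP
    have hPl : n * (p₀ * (z b - z a)) ≤ P := mul_le_mul_of_nonneg_left hp1 hn0.le
    have hDl : 4 * u₁ ^ 2 * Real.log n ≤ n * (p₀ * (z b - z a)) := by
      rw [div_mul_eq_mul_div, div_div, div_le_iff₀ (by positivity)] at hD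
      linarith
    have hP0 : 0 < P := lt_of_lt_of_le (by positivity) hPl
    have hsq : u₁ * √(Real.log n * P) ≤ P / 2 := by
      rw [← abs_of_pos hu₁, ← Real.sqrt_sq_eq_abs, ← Real.sqrt_mul (sq_nonneg _)]
      refine Real.sqrt_le_iff.mpr ⟨by linarith, ?_⟩
      nlinarith
    linarith
  · intro a b hab d hD hd
    have hlen : 0 < z b - z a := by linarith [hz hab]
    have hc := (abs_le.mp (abs_card_sub_le hz hΩ hab)).2
    obtain ⟨hp1, hp2⟩ := hpI (z a) (z b) (hz hab).le
    set P := (n : ℝ) * pI (z a) (z b) with hP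
    have hd0 : 0 < d := hlen.trans_le hd
    have hp₁ : 0 < p₁ := hp₀.trans_le hp₀₁
    have hP0 : 0 ≤ P := mul_nonneg hn0.le (le_trans (by positivity) hp1)
    have hPu : P ≤ n * p₁ * d := by
      have : pI (z a) (z b) ≤ p₁ * d := hp2.trans (mul_le_mul_of_nonneg_left hd hp₁.le)
      calc P ≤ n * (p₁ * d) := mul_le_mul_of_nonneg_left this hn0.le
        _ = _ := by ring
    have hDl : 4 * u₁ ^ 2 * Real.log n ≤ n * p₁ * d := by
      rw [div_mul_eq_mul_div, div_div, div_le_iff₀ (by positivity)] at hD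
      calc _ ≤ d * (p₀ * n) := hD
        _ = n * p₀ * d := by ring
        _ ≤ _ := by gcongr
    have hsq : u₁ * √(Real.log n * P) ≤ n * p₁ * d / 2 := by
      rw [← abs_of_pos hu₁, ← Real.sqrt_sq_eq_abs, ← Real.sqrt_mul (sq_nonneg _)]
      refine Real.sqrt_le_iff.mpr ⟨by positivity, ?_⟩
      have := mul_le_mul hDl hPu hP0 (by positivity)
      nlinarith
    linarith
  · have h1 : h * epsn t n x ^ 2 = r⁻¹ := by
      rw [epsn, ← Real.rpow_natCast, ← Real.rpow_mul hr0.le, ← Real.rpow_add hr0,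
        ← Real.rpow_neg_one]
      congr 1
      push_cast
      field_simp
      ring
    rw [mul_assoc, h1, hr]
    field_simp
  · intro y hy hyx
    have he0 : 0 < epsn t n x := Real.rpow_pos_of_pos hr0 _
    rcases eq_or_ne y x with rfl | hne
    · rw [sub_self, abs_zero]
      positivity
    have hb := hf₀.2 (y - x) (sub_ne_zero.mpr hne) (by linarith) (by simpa using hy)
    rw [add_sub_cancel] at hb
    have hpow : |y - x| ^ t x ≤ 2 * epsn t n x := by
      calc _ ≤ (2 * h) ^ t x := Real.rpow_le_rpow (abs_nonneg _) hyx ht0.le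
        _ = 2 ^ t x * epsn t n x := by rw [Real.mul_rpow (by norm_num) hh0.le, hht]
        _ ≤ 2 * epsn t n x := by
          gcongr
          conv_rhs => rw [← Real.rpow_one 2]
          exact Real.rpow_le_rpow_of_exponent_le (by norm_num) htu
    calc _ ≤ M x * |y - x| ^ t x := hb
      _ ≤ Mmax * (2 * epsn t n x) := mul_le_mul hM hpow (by positivity) hMmax.le
      _ = _ := by ring

end Design

section IntegratedBound

variable {n N : ℕ} {z : Knot N → ℝ} {xd : Fin n → ℝ} {g : Knot N → ℝ → ℝ} {c₀ c₁ B₀ B : ℝ}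

lemma pairBound_nonneg {θ τ R : ℝ} (hR : 0 ≤ R) (m : ℝ) (t : Knot N × Knot N × Knot N)
    (ε : Fin n → ℝ) : 0 ≤ pairBound θ τ R m xd z t ε := by
  unfold pairBound
  have := Real.rpow_nonneg hR θ
  positivity

lemma coefBound_nonneg {L : ℝ} (hL : 0 < L) (m : ℝ) (u : Knot N × Knot N × Knot N × Knot N)
    (ε : Fin n → ℝ) : 0 ≤ coefBound L m xd z u ε := by
  unfold coefBound
  positivity

lemma partPost_le_sum_bounds (hz : StrictMono z) (h0 : z 0 = 0) (h1 : z (Fin.last N) = 1)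
    (hg : ∀ j, IsGoodDensity c₀ c₁ B₀ (g j)) (hc₀ : 0 < c₀) (hc₁ : 0 ≤ c₁) (hB : 0 ≤ B)
    (f ε : Fin n → ℝ) {ρ s θ τ d m₁ b₀ : ℝ} (m₂ : ℝ) (hρ : 0 < ρ) (hρ1 : ρ ≤ 1) (hs : 0 < s)
    (hs1 : s ≤ 1) (hsp : ∀ a b : Knot N, a < b → s ≤ z b - z a) (hb₀ : b₀ + ρ ≤ B₀)
    (hf : ∀ q, |avg f (pts xd z q)| ≤ b₀) (hτ : 0 < τ) (hθ : 0 < θ) (hθ1 : θ ≤ 1) (hd : 0 ≤ d)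
    {A : Finset (Knot N) → (Knot N → ℝ) → Prop}
    (hA : ∀ S β, IsPart N S → A S β →
      (∃ i j k, Consec N S i j ∧ Consec N S j k ∧ min (z j - z i) (z k - z j) ≤ d ∧
        ∃ v, |v| ≤ b₀ ∧ mergeLoss f xd z i j k v ≤ m₁) ∨
      ∃ i a b k, Consec N S i k ∧ i ≤ a ∧ a < b ∧ b ≤ k ∧
        β k ∈ farSet f (pts xd z (a, b)) m₂) :
    partPost n N z xd B g (fun l => f l + ε l) A ≤
      ∑ t : Knot N × Knot N × Knot N, pairBound θ τ (d ^ B * mergeConst c₀ c₁ ρ) m₁ xd z t ε +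
      ∑ u : Knot N × Knot N × Knot N × Knot N, coefBound (massFloor n B c₀ ρ s) m₂ xd z u ε := by
  have hR : 0 ≤ d ^ B * mergeConst c₀ c₁ ρ :=
    mul_nonneg (Real.rpow_nonneg hd B) (mergeConst_pos hc₀ hc₁ hρ).le
  set P : Finset (Knot N × Knot N × Knot N) := Finset.univ.filter fun t =>
    t.1 < t.2.1 ∧ t.2.1 < t.2.2 ∧ min (z t.2.1 - z t.1) (z t.2.2 - z t.2.1) ≤ d ∧
      ∃ v, |v| ≤ b₀ ∧ mergeLoss f xd z t.1 t.2.1 t.2.2 v ≤ m₁ with hP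
  set Q : Finset (Knot N × Knot N × Knot N × Knot N) := Finset.univ.filter fun u =>
    u.1 ≤ u.2.1 ∧ u.2.1 < u.2.2.1 ∧ u.2.2.1 ≤ u.2.2.2 with hQ
  refine (partPost_le hz hg (P := P) (Q := Q)
    (T := fun u => farSet f (pts xd z (u.2.1, u.2.2.1)) m₂)
    (fun u => measurableSet_farSet _ _ _) ?_).trans (add_le_add ?_ ?_)
  · intro S β hS hAS
    rcases hA S β hS hAS with ⟨i, j, k, hij, hjk, hmin, hv⟩ | ⟨i, a, b, k, hik, hia, hab, hbk, hβ⟩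
    · exact Or.inl ⟨(i, j, k), by simpa [hP] using ⟨hij.2.2.1, hjk.2.2.1, by simpa using hmin, hv⟩,
        hij, hjk⟩
    · exact Or.inr ⟨(i, a, b, k), by simp [hQ, hia, hab, hbk], hik, hβ⟩
  · calc _ ≤ ∑ t ∈ P, pairBound θ τ (d ^ B * mergeConst c₀ c₁ ρ) m₁ xd z t ε := by
          refine Finset.sum_le_sum fun t ht => ?_
          obtain ⟨i, j, k⟩ := t
          simp only [hP, Finset.mem_filter, Finset.mem_univ, true_and] at ht
          obtain ⟨hij, hjk, hmin, v, hv, hle⟩ := ht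
          exact postPair_le_pairBound hz h0 h1 hg hc₀ hc₁ hB hij hjk f ε hρ hρ1 (by linarith) hτ hθ
            hθ1 hmin hle
      _ ≤ _ := Finset.sum_le_sum_of_subset_of_nonneg (Finset.subset_univ _)
          fun t _ _ => pairBound_nonneg hR _ _ _
  · calc _ ≤ ∑ u ∈ Q, coefBound (massFloor n B c₀ ρ s) m₂ xd z u ε := by
          refine Finset.sum_le_sum fun u hu => ?_
          obtain ⟨i, a, b, k⟩ := u
          simp only [hQ, Finset.mem_filter, Finset.mem_univ, true_and] at hu
          exact postCoef_le_coefBound hz h0 h1 hg hc₀ hB hu.1 hu.2.1 hu.2.2 f ε m₂ hρ hρ1 hs hs1 hsp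
            fun q => by linarith [hf q]
      _ ≤ _ := Finset.sum_le_sum_of_subset_of_nonneg (Finset.subset_univ _)
          fun u _ _ => coefBound_nonneg (massFloor_pos hc₀ hρ hs) _ _ _

lemma integral_partPost_le (hz : StrictMono z) (h0 : z 0 = 0) (h1 : z (Fin.last N) = 1)
    (hg : ∀ j, IsGoodDensity c₀ c₁ B₀ (g j)) (hc₀ : 0 < c₀) (hc₁ : 0 ≤ c₁) (hB : 0 ≤ B)
    (f : Fin n → ℝ) {ρ s θ τ d m₁ b₀ : ℝ} (m₂ : ℝ) (hρ : 0 < ρ) (hρ1 : ρ ≤ 1) (hs : 0 < s)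
    (hs1 : s ≤ 1) (hsp : ∀ a b : Knot N, a < b → s ≤ z b - z a) (hb₀ : b₀ + ρ ≤ B₀)
    (hf : ∀ q, |avg f (pts xd z q)| ≤ b₀) (hτ : 0 < τ) (hθ : 0 < θ) (hθτ : θ * (1 + τ) < 1)
    (hd : 0 ≤ d) {A : Finset (Knot N) → (Knot N → ℝ) → Prop}
    (hA : ∀ S β, IsPart N S → A S β →
      (∃ i j k, Consec N S i j ∧ Consec N S j k ∧ min (z j - z i) (z k - z j) ≤ d ∧
        ∃ v, |v| ≤ b₀ ∧ mergeLoss f xd z i j k v ≤ m₁) ∨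
      ∃ i a b k, Consec N S i k ∧ i ≤ a ∧ a < b ∧ b ≤ k ∧
        β k ∈ farSet f (pts xd z (a, b)) m₂) :
    ∫ ε, partPost n N z xd B g (fun l => f l + ε l) A ∂regNoise n ≤
      ((N : ℝ) + 1) ^ 3 * ((d ^ B * mergeConst c₀ c₁ ρ) ^ θ *
        Real.exp (θ * (1 / 2 * (1 + τ⁻¹) * m₁)) * (1 - θ * (1 + τ))⁻¹ ^ 2) +
      ((N : ℝ) + 1) ^ 4 * ((massFloor n B c₀ ρ s)⁻¹ ^ 3 * Real.exp (-(m₂ / 32)) * 8) := by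
  have hR : 0 ≤ d ^ B * mergeConst c₀ c₁ ρ :=
    mul_nonneg (Real.rpow_nonneg hd B) (mergeConst_pos hc₀ hc₁ hρ).le
  have hL := massFloor_pos (n := n) (B := B) hc₀ hρ hs
  have hpair := fun t => integral_pairBound (xd := xd) (z := z) hθ.le hτ.le hθτ hR m₁ t
  have hcoef := fun u => integral_coefBound (xd := xd) (z := z) hL m₂ u
  have hθ1 : θ ≤ 1 := by nlinarith [mul_pos hθ hτ]
  have hi1 := integrable_finsetSum Finset.univ fun t _ => (hpair t).1
  have hi2 := integrable_finsetSum Finset.univ fun u _ => (hcoef u).1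
  refine (integral_mono_of_nonneg (Eventually.of_forall fun ε => partPost_nonneg hz A)
    (hi1.add hi2) (Eventually.of_forall fun ε => partPost_le_sum_bounds hz h0 h1 hg hc₀ hc₁ hB f ε
      m₂ hρ hρ1 hs hs1 hsp hb₀ hf hτ hθ hθ1 hd hA)).trans ?_
  simp only [Pi.add_apply]
  rw [integral_add hi1 hi2, integral_finsetSum _ fun t _ => (hpair t).1,
    integral_finsetSum _ fun u _ => (hcoef u).1]
  refine add_le_add ?_ ?_
  · refine (Finset.sum_le_card_nsmul _ _ _ fun t _ => (hpair t).2).trans_eq ?_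
    rw [nsmul_eq_mul]
    congr 1
    simp
    ring
  · refine (Finset.sum_le_card_nsmul _ _ _ fun u _ => (hcoef u).2).trans_eq ?_
    rw [nsmul_eq_mul]
    congr 1
    simp
    ring

end IntegratedBound


lemma tendsto_log_rpow_mul_rpow_neg (a : ℝ) {b : ℝ} (hb : 0 < b) :
    Tendsto (fun n : ℕ => Real.log n ^ a * (n : ℝ) ^ (-b)) atTop (nhds 0) := by
  have h := ((isLittleO_log_rpow_rpow_atTop a hb).tendsto_div_nhds_zero).comp
    tendsto_natCast_atTop_atTop
  refine h.congr fun n => ?_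
  simp only [Function.comp]
  rw [Real.rpow_neg n.cast_nonneg, div_eq_mul_inv]

lemma tendsto_div_log_atTop : Tendsto (fun n : ℕ => (n : ℝ) / Real.log n) atTop atTop := by
  have h : Tendsto (fun n : ℕ => Real.log n / (n : ℝ)) atTop (nhdsWithin 0 (Ioi 0)) := by
    refine tendsto_nhdsWithin_iff.mpr ⟨?_, ?_⟩
    · refine (tendsto_log_rpow_mul_rpow_neg 1 one_pos).congr fun n => ?_
      rw [Real.rpow_one, Real.rpow_neg_one, div_eq_mul_inv]
    · filter_upwards [eventually_ge_atTop 2] with n hn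
      have hn' : (2 : ℝ) ≤ n := by exact_mod_cast hn
      exact div_pos (Real.log_pos (by linarith)) (by linarith)
  exact h.inv_tendsto_nhdsGT_zero.congr fun n => by simp [inv_div]

lemma eventually_mul_inv_le_rpow_neg (K : ℝ) {δ a : ℝ} (hδ : 0 < δ) (ha : a < 1) :
    ∀ᶠ r : ℝ in atTop, K * r⁻¹ ≤ δ * r ^ (-a) := by
  filter_upwards [(tendsto_rpow_atTop (sub_pos.mpr ha)).eventually_ge_atTop (K / δ),
    eventually_gt_atTop 0] with r hr hr0
  rw [div_le_iff₀ hδ, Real.rpow_sub hr0, Real.rpow_one] at hr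
  rw [Real.rpow_neg hr0.le, mul_inv_le_iff₀ hr0]
  calc K ≤ r / r ^ a * δ := hr
    _ = δ * (r ^ a)⁻¹ * r := by ring

lemma merge_term_le {n N : ℕ} {B θ κ w k q : ℝ} (hn : 2 ≤ n) (hN : (N : ℝ) ≤ n)
    (hκ : B * θ / 3 = 3 + κ) (hw : w ≤ κ / 2) (hk : 0 < k) (hq : 0 ≤ q) :
    ((N : ℝ) + 1) ^ 3 * (((((n : ℝ) / Real.log n) ^ (-(1 / 3) : ℝ)) ^ B * k) ^ θ *
        Real.exp (w * Real.log n) * q) ≤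
      8 * k ^ θ * q * (Real.log n ^ (3 + κ) * (n : ℝ) ^ (-(κ / 2))) := by
  have hn' : (2 : ℝ) ≤ n := by exact_mod_cast hn
  have hL : 0 < Real.log n := Real.log_pos (by linarith)
  have hn0 : (0 : ℝ) < n := by linarith
  have hr0 : 0 < (n : ℝ) / Real.log n := by positivity
  have hrate : ((((n : ℝ) / Real.log n) ^ (-(1 / 3) : ℝ)) ^ B * k) ^ θ =
      (n : ℝ) ^ (-(3 + κ)) * Real.log n ^ (3 + κ) * k ^ θ := by
    rw [Real.mul_rpow (by positivity) hk.le, ← Real.rpow_mul hr0.le, ← Real.rpow_mul hr0.le,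
      show -(1 / 3) * B * θ = -(3 + κ) by rw [← hκ]; ring, Real.div_rpow hn0.le hL.le,
      Real.rpow_neg hL.le, div_inv_eq_mul]
  have hexp : Real.exp (w * Real.log n) ≤ (n : ℝ) ^ (κ / 2) := by
    rw [Real.rpow_def_of_pos hn0, mul_comm (Real.log _)]
    gcongr
  have hcube : ((N : ℝ) + 1) ^ 3 ≤ 8 * (n : ℝ) ^ (3 : ℝ) := by
    rw [show (3 : ℝ) = ((3 : ℕ) : ℝ) by norm_num, Real.rpow_natCast]
    calc ((N : ℝ) + 1) ^ 3 ≤ (2 * n) ^ 3 := by gcongr; linarith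
      _ = 8 * (n : ℝ) ^ 3 := by ring
  rw [hrate]
  calc _ ≤ 8 * (n : ℝ) ^ (3 : ℝ) * ((n : ℝ) ^ (-(3 + κ)) * Real.log n ^ (3 + κ) * k ^ θ *
        (n : ℝ) ^ (κ / 2) * q) := by gcongr
    _ = 8 * k ^ θ * q * (Real.log n ^ (3 + κ) *
        ((n : ℝ) ^ (3 : ℝ) * (n : ℝ) ^ (-(3 + κ)) * (n : ℝ) ^ (κ / 2))) := by ring
    _ = _ := by
      rw [← Real.rpow_add hn0, ← Real.rpow_add hn0]
      congr 4
      ring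

lemma far_term_le {n N : ℕ} {B c₀ ρ : ℝ} (hn : 2 ≤ n) (hN : (N : ℝ) ≤ n) (hc₀ : 0 < c₀)
    (hρ : 0 < ρ) :
    ((N : ℝ) + 1) ^ 4 * ((massFloor n B c₀ ρ (1 / n))⁻¹ ^ 3 *
        Real.exp (-(32 * (3 * B + 8) * Real.log n / 32)) * 8) ≤
      128 * (min (c₀ * ρ * Real.exp (-(1 / 2))) 1)⁻¹ ^ 3 * (n : ℝ)⁻¹ := by
  have hn' : (2 : ℝ) ≤ n := by exact_mod_cast hn
  have hn0 : (0 : ℝ) < n := by linarith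
  set k := min (c₀ * ρ * Real.exp (-(1 / 2))) 1 with hk
  have hk0 : 0 < k := lt_min (by positivity) one_pos
  have hsqrt : √((n : ℝ) + 1) ≤ n := Real.sqrt_le_iff.mpr ⟨hn0.le, by nlinarith⟩
  have hfloor : (massFloor n B c₀ ρ (1 / n))⁻¹ ≤ k⁻¹ * (n : ℝ) ^ (B + 1) := by
    rw [massFloor, ← hk, mul_inv, mul_inv, inv_inv, one_div, Real.inv_rpow hn0.le, inv_inv,
      Real.rpow_add hn0, Real.rpow_one]
    calc (n : ℝ) ^ B * k⁻¹ * √((n : ℝ) + 1) ≤ (n : ℝ) ^ B * k⁻¹ * n := by gcongr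
      _ = _ := by ring
  have hpos : 0 ≤ (massFloor n B c₀ ρ (1 / n))⁻¹ :=
    (inv_pos.mpr (massFloor_pos hc₀ hρ (by positivity))).le
  have hexp : Real.exp (-(32 * (3 * B + 8) * Real.log n / 32)) = (n : ℝ) ^ (-(3 * B + 8)) := by
    rw [Real.rpow_def_of_pos hn0]
    congr 1
    ring
  rw [hexp]
  calc _ ≤ (2 * (n : ℝ)) ^ 4 * ((k⁻¹ * (n : ℝ) ^ (B + 1)) ^ 3 * (n : ℝ) ^ (-(3 * B + 8)) * 8) := by
        gcongr
        linarith
    _ = 128 * k⁻¹ ^ 3 *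
        ((n : ℝ) ^ 4 * ((n : ℝ) ^ (B + 1)) ^ 3 * (n : ℝ) ^ (-(3 * B + 8))) := by ring
    _ = _ := by
      rw [← Real.rpow_natCast (n : ℝ) 4, ← Real.rpow_natCast ((n : ℝ) ^ (B + 1)) 3, ← Real.rpow_mul hn0.le,
        ← Real.rpow_add hn0, ← Real.rpow_add hn0, ← Real.rpow_neg_one (n : ℝ)]
      congr 2
      push_cast
      ring

/-- Theorem 4.2: exact-rate uniform spatial adaptation of the
repulsive partition prior: with B > 9, C₁ > 32 p₀ and sup|f₀| < B₀, under Assumptions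
A1 and A4, there is M̃ > 0 with E_{f₀}[1_{Ω_n(u₁)} Π(A_{ε_n}^c(M̃) | D_n)] = o(1). -/
theorem statement16
    (t M η : ℝ → ℝ) (t₁ : ℝ) (hA1 : A1 t M η t₁) (hA4 : A4 t)
    (B C₁ C₂ B₀ c₀ c₁ p₀ p₁ u₁ : ℝ)
    (hB : 9 < B) (hC₁ : 32 * p₀ < C₁) (hC₁₂ : C₁ ≤ C₂)
    (hB₀ : 0 < B₀) (hc₀ : 0 < c₀) (hc₀₁ : c₀ ≤ c₁)
    (hp₀ : 0 < p₀) (hp₀₁ : p₀ ≤ p₁) (hu₁ : 0 < u₁)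
    (f₀ : ℝ → ℝ) (hf₀ : f₀ ∈ HolderClass t M η)
    (hf₀B : ∃ b : ℝ, (∀ y ∈ Set.Icc (0 : ℝ) 1, |f₀ y| ≤ b) ∧ b < B₀)
    (Nf : ℕ → ℕ) (z : ∀ n : ℕ, Knot (Nf n) → ℝ) (xd : ∀ n : ℕ, Fin n → ℝ)
    (g : ∀ n : ℕ, Knot (Nf n) → ℝ → ℝ) (pI : ℕ → ℝ → ℝ → ℝ)
    (hgrid : ∀ n : ℕ, 2 ≤ n → IsGrid n (Nf n) (z n) C₁ C₂)
    (hdens : ∀ n : ℕ, GoodDens (Nf n) (g n) c₀ c₁ B₀)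
    (hpI : ∀ n : ℕ, ∀ a b : ℝ, a ≤ b → p₀ * (b - a) ≤ pI n a b ∧ pI n a b ≤ p₁ * (b - a)) :
    ∃ Mt > (0 : ℝ),
      Tendsto (fun n : ℕ =>
          (if ∀ ℓ : Knot (Nf n), ℓ ≠ 0 →
              OmegaX n (Nf n) (xd n) (z n) (pI n) u₁ (z n ℓ) then (1 : ℝ) else 0) *
            ∫ ε, partPost n (Nf n) (z n) (xd n) B (g n) (fun i => f₀ (xd n i) + ε i)
                (fun S β => ∃ x ∈ Set.Ioo (0 : ℝ) 1,
                  Mt * epsn t n x < |fPart (Nf n) (z n) S β x - f₀ x|)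
              ∂regNoise n)
        atTop (nhds 0) := by
  obtain ⟨Mmax, hMmax, hM⟩ := hA1.M_ub
  obtain ⟨emin, hemin, hη⟩ := hA1.eta_lb
  obtain ⟨b, hb, hbB⟩ := hf₀B
  have ht₁ := hA1.ht₁
  have hC₁0 : 0 < C₁ := by linarith
  have hp₁ : 0 < p₁ := hp₀.trans_le hp₀₁
  have hc₁ : 0 ≤ c₁ := hc₀.le.trans hc₀₁
  have hb0 : 0 ≤ b := (abs_nonneg _).trans (hb 0 ⟨le_rfl, zero_le_one⟩)
  set ρ := min 1 (B₀ - b) with hρd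
  have hρ : 0 < ρ := lt_min one_pos (by linarith)
  have hρ1 : ρ ≤ 1 := min_le_left _ _
  have hbρ : b + ρ ≤ B₀ := by linarith [min_le_right 1 (B₀ - b)]
  set θ := (9 / B + 1) / 2 with hθd
  have h9B : 9 / B < 1 := (div_lt_one (by linarith)).mpr hB
  have hθ : 0 < θ := by positivity
  have hθ1 : θ < 1 := by rw [hθd]; linarith
  set τ := (1 / θ - 1) / 2 with hτd
  have hτ : 0 < τ := by
    have := (one_lt_div hθ).mpr hθ1
    rw [hτd]; linarith
  have hθτ : θ * (1 + τ) < 1 := by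
    have : θ * (1 + τ) = (θ + 1) / 2 := by rw [hτd]; field_simp; ring
    linarith
  set κ := B * θ / 3 - 3 with hκd
  have hκ : 0 < κ := by
    have : B * θ = (9 + B) / 2 := by rw [hθd]; field_simp
    rw [hκd, this]; linarith
  set c := κ / 2 / (θ * (1 / 2 * (1 + τ⁻¹))) with hcd
  have hc : 0 < c := by positivity
  set Λ := 32 * (3 * B + 8) with hΛ
  set q₀ := 3 / 2 * p₁ * (2 * (2 * Mmax) + 2 * √(Λ / (p₀ / 2 / 8))) ^ 2 with hq₀d
  have hq₀ : 0 ≤ q₀ := by positivity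
  set δ := min 1 (c / (q₀ + 1)) with hδd
  have hδ : 0 < δ := lt_min one_pos (by positivity)
  have hδ1 : δ ≤ 1 := min_le_left _ _
  have hqδ : q₀ * δ ≤ c := by
    calc q₀ * δ ≤ (q₀ + 1) * (c / (q₀ + 1)) := by
          gcongr
          · linarith
          · exact min_le_right _ _
      _ = c := by field_simp
  have ha1 : 1 / (2 * t₁ + 1) < 1 := (div_lt_one (by positivity)).mpr (by linarith)
  have hr3 : Tendsto (fun n : ℕ => ((n : ℝ) / Real.log n) ^ (-(1 / 3) : ℝ)) atTop (nhds 0) :=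
    (tendsto_rpow_neg_atTop (by norm_num)).comp tendsto_div_log_atTop
  set k := mergeConst c₀ c₁ ρ with hkd
  have hk : 0 < k := mergeConst_pos hc₀ hc₁ hρ
  set q := (1 - θ * (1 + τ))⁻¹ ^ 2 with hqd
  refine ⟨2 * Mmax + √(Λ / (p₀ / 2 * δ / 8)), by positivity, ?_⟩
  have hlim : Tendsto (fun n : ℕ =>
      8 * k ^ θ * q * (Real.log n ^ (3 + κ) * (n : ℝ) ^ (-(κ / 2))) +
      128 * (min (c₀ * ρ * Real.exp (-(1 / 2))) 1)⁻¹ ^ 3 * (n : ℝ)⁻¹) atTop (nhds 0) := by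
    simpa only [mul_zero, add_zero] using ((tendsto_log_rpow_mul_rpow_neg (3 + κ) (half_pos hκ)).const_mul
      (8 * k ^ θ * q)).add (tendsto_inv_atTop_nhds_zero_nat.const_mul
        (128 * (min (c₀ * ρ * Real.exp (-(1 / 2))) 1)⁻¹ ^ 3))
  refine squeeze_zero' ?_ ?_ hlim
  · filter_upwards [eventually_ge_atTop 2] with n hn
    exact mul_nonneg (by split_ifs <;> norm_num) (integral_nonneg fun ε =>
      partPost_nonneg ((hgrid n hn).strictMono hC₁0 hn) _)
  filter_upwards [eventually_ge_atTop 2, tendsto_div_log_atTop.eventually_ge_atTop 1,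
    (hr3.const_mul 2).eventually_le_const (by rwa [mul_zero] : 2 * 0 < emin), hr3.eventually_lt_const one_pos,
    tendsto_div_log_atTop.eventually
      (eventually_mul_inv_le_rpow_neg (8 * (4 * u₁ ^ 2 / p₀)) hδ ha1),
    tendsto_div_log_atTop.eventually (eventually_mul_inv_le_rpow_neg (8 * C₂) hδ ha1),
    ((Real.tendsto_log_atTop.comp tendsto_natCast_atTop_atTop).const_mul_atTop
      hC₁0).eventually_ge_atTop 1] with n hn hr1 hr2 hr4 hD hG hlog
  have hn' : (2 : ℝ) ≤ n := by exact_mod_cast hn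
  have hn0 : (0 : ℝ) < n := by linarith
  have hL : 0 < Real.log n := Real.log_pos (by linarith)
  have hz := (hgrid n hn).strictMono hC₁0 hn
  have h0 := (hgrid n hn).1
  have h1 := (hgrid n hn).2.1
  have hstep : 1 / (n : ℝ) ≤ C₁ * Real.log n / n := by
    gcongr
    exact hlog
  have hN : (Nf n : ℝ) ≤ n := by
    have h := (mul_le_mul_of_nonneg_left hstep (Nf n).cast_nonneg).trans
      ((hgrid n hn).card_le)
    rwa [mul_one_div, div_le_one hn0] at h
  have havg : ∀ p, |avg (fun l => f₀ (xd n l)) (pts (xd n) (z n) p)| ≤ b := fun p =>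
    abs_avg_le hb0 fun l hl => hb _ (pts_subset_Icc hz h0 h1 hl)
  have hbound : 0 ≤ 8 * k ^ θ * q * (Real.log n ^ (3 + κ) * (n : ℝ) ^ (-(κ / 2))) +
      128 * (min (c₀ * ρ * Real.exp (-(1 / 2))) 1)⁻¹ ^ 3 * (n : ℝ)⁻¹ := by
    positivity
  split_ifs with hΩ
  swap
  · rwa [zero_mul]
  rw [one_mul]
  refine (integral_partPost_le (s := 1 / n) (θ := θ) (τ := τ)
    (d := ((n : ℝ) / Real.log n) ^ (-(1 / 3) : ℝ)) (m₁ := c * Real.log n) (b₀ := b)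
    hz h0 h1 (fun j => ⟨(hdens n j).1, (hdens n j).2.1, (hdens n j).2.2.1, (hdens n j).2.2.2⟩)
    hc₀ hc₁ (by linarith) (fun l => f₀ (xd n l)) (Λ * Real.log n) hρ hρ1 (by positivity)
    (by rw [div_le_one hn0]; linarith)
    (fun a b hab => hstep.trans ((hgrid n hn).le_sub hC₁0 hn hab))
    hbρ havg hτ hθ hθτ (by positivity) ?_).trans ?_
  · rintro S β hS ⟨x, hx, hfar⟩
    have hxI : x ∈ Icc (0 : ℝ) 1 := ⟨hx.1.le, hx.2.le⟩
    obtain ⟨h, H, hhle, hleh⟩ := LocalSetup.of_design (hgrid n hn) hC₁0 hC₁₂ hn hp₀ hp₀₁ hu₁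
      (hpI n) hΩ ht₁ (hA1.t_lb x hxI) (hA1.t_ub x hxI) hMmax (hM x hxI) (hη x hxI) (hf₀ x hxI)
      hr1 hr2
    by_cases hβ : ∀ i a b k, Consec (Nf n) S i k → i ≤ a → a < b → b ≤ k →
      (pts (xd n) (z n) (a, b)).card *
        (β k - avg (fun l => f₀ (xd n l)) (pts (xd n) (z n) (a, b))) ^ 2 ≤ Λ * Real.log n
    · left
      have hδh := mul_le_mul_of_nonneg_left hleh hδ.le
      obtain ⟨i, j, m, hij, hjm, hmin, v, hv, hloss⟩ := H.exists_mergeable hδ hδ1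
        ((le_of_eq (by field_simp)).trans (hD.trans hδh))
        ((le_of_eq (by field_simp)).trans (hG.trans hδh))
        (by positivity) (hhle.trans_lt hr4) havg hS hβ ⟨hx.1, hx.2.le⟩ hfar
      refine ⟨i, j, m, hij, hjm, hmin.trans hhle, v, hv, hloss.trans ?_⟩
      gcongr
      exact (le_of_eq (by rw [hq₀d]; ring)).trans hqδ
    · right
      push Not at hβ
      obtain ⟨i, a, b, m, him, hia, hab, hbm, hlt⟩ := hβ
      exact ⟨i, a, b, m, him, hia, hab, hbm, hlt.le⟩
  · refine add_le_add ?_ (far_term_le hn hN hc₀ hρ)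
    rw [show θ * (1 / 2 * (1 + τ⁻¹) * (c * Real.log n)) = κ / 2 * Real.log n by
      rw [hcd]; field_simp]
    exact merge_term_le hn hN (by rw [hκd]; ring) le_rfl hk (sq_nonneg _)

end Spatial
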